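/- arXiv:2202.03111 — 2 statements merged into one kernel-verified Lean document; each statement's English description precedes it below -/
import Mathlib

section
/- Let ω be an admissible weight on ℤ^d satisfying the weak growth condition, let 0<p≤1, and let A ∈ A_{pω} be a self-adjoint matrix, i.e. a_{kl} = conj(a_{lk}) for all k,l ∈ ℤ^d. Then lim_{n→∞} ‖A^n‖_{pω}^{1/n} = ‖A‖_op^p, where A^n is the n-fold matrix product and ‖A‖_op is the operator norm of A acting on ℓ²(ℤ^d); that is, the spectral radius of A in the p-Banach algebra A_{pω} equals ‖A‖_op^p. -/
open scoped ENNReal NNReal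
open Filter

/-- An admissible weight on `ℝ^d`: `ω(x) = e^{ρ(|x|)}` for some norm `|·|` on `ℝ^d` and a
continuous concave `ρ : [0,∞) → [0,∞)` with `ρ(0) = 0`, satisfying the GRS-condition
`lim_n ω(nx)^{1/n} = 1` for every `x`. -/
def IsAdmissibleWeight {d : ℕ} (ω : (Fin d → ℝ) → ℝ) : Prop :=
  (∃ (N : (Fin d → ℝ) → ℝ) (ρ : ℝ → ℝ),
    (∀ x, 0 ≤ N x) ∧ (∀ x, N x = 0 ↔ x = 0) ∧
    (∀ x y, N (x + y) ≤ N x + N y) ∧ (∀ (c : ℝ) (x), N (c • x) = |c| * N x) ∧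
    ContinuousOn ρ (Set.Ici 0) ∧ ConcaveOn ℝ (Set.Ici 0) ρ ∧
    ρ 0 = 0 ∧ (∀ t : ℝ, 0 ≤ t → 0 ≤ ρ t) ∧
    (∀ x, ω x = Real.exp (ρ (N x)))) ∧
  (∀ x, Filter.Tendsto (fun n : ℕ => ω ((n : ℝ) • x) ^ ((n : ℝ)⁻¹)) Filter.atTop (nhds 1))

/-- The weak growth condition: `ω(x) ≥ C (1 + |x|)^δ` for some `C > 0`, `0 < δ ≤ 1`. -/
def WeakGrowth {d : ℕ} (ω : (Fin d → ℝ) → ℝ) : Prop :=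
  ∃ C : ℝ, 0 < C ∧ ∃ δ : ℝ, 0 < δ ∧ δ ≤ 1 ∧ ∀ x, C * (1 + ‖x‖) ^ δ ≤ ω x

/-- The canonical embedding `ℤ^d → ℝ^d`. -/
def zr {d : ℕ} (k : Fin d → ℤ) : Fin d → ℝ := fun i => (k i : ℝ)

/-- The weighted Schur-type `p`-norm of an infinite matrix `A = (a_{kl})_{k,l ∈ ℤ^d}` with
respect to a weight `ν` on `ℤ^d` (valued in `ℝ≥0∞`):
`max{ sup_k Σ_l |a_{kl}|^p ν(k−l)^p , sup_l Σ_k |a_{kl}|^p ν(k−l)^p }`. -/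
noncomputable def mnorm {d : ℕ} (p : ℝ) (ν : (Fin d → ℤ) → ℝ)
    (A : (Fin d → ℤ) → (Fin d → ℤ) → ℂ) : ℝ≥0∞ :=
  max (⨆ k : Fin d → ℤ, ∑' l : Fin d → ℤ,
        (‖A k l‖₊ : ℝ≥0∞) ^ p * ENNReal.ofReal (ν (k - l)) ^ p)
      (⨆ l : Fin d → ℤ, ∑' k : Fin d → ℤ,
        (‖A k l‖₊ : ℝ≥0∞) ^ p * ENNReal.ofReal (ν (k - l)) ^ p)

/-- Product of infinite matrices: `(A ⋆ B)_{kl} = Σ_j a_{kj} b_{jl}`. -/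
noncomputable def matmul {d : ℕ} (A B : (Fin d → ℤ) → (Fin d → ℤ) → ℂ) :
    (Fin d → ℤ) → (Fin d → ℤ) → ℂ :=
  fun k l => ∑' j : Fin d → ℤ, A k j * B j l

/-- `matpow A n` is the `(n+1)`-fold matrix power `A^{n+1}`. -/
noncomputable def matpow {d : ℕ} (A : (Fin d → ℤ) → (Fin d → ℤ) → ℂ) :
    ℕ → (Fin d → ℤ) → (Fin d → ℤ) → ℂ
  | 0 => A
  | n + 1 => matmul A (matpow A n)

section ConcaveGrowth

variable {ρ : ℝ → ℝ}

/-- Increments of a concave function decrease. -/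
lemma ConcaveOn.add_sub_le_add_sub (hρ : ConcaveOn ℝ (Set.Ici 0) ρ) {a b h : ℝ} (ha : 0 ≤ a)
    (hab : a ≤ b) (hh : 0 ≤ h) : ρ (b + h) - ρ b ≤ ρ (a + h) - ρ a := by
  rcases hh.eq_or_lt with rfl | hh
  · simp
  have hD : 0 < b + h - a := by linarith
  have hA : 0 ≤ (b - a) / (b + h - a) := div_nonneg (by linarith) hD.le
  have hB : 0 ≤ h / (b + h - a) := by positivity
  have h1 := hρ.2 (Set.mem_Ici.2 ha) (Set.mem_Ici.2 (by linarith : 0 ≤ b + h)) hA hB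
    (by field_simp; ring)
  have h2 := hρ.2 (Set.mem_Ici.2 ha) (Set.mem_Ici.2 (by linarith : 0 ≤ b + h)) hB hA
    (by field_simp; ring)
  simp only [smul_eq_mul] at h1 h2
  have e1 : (b - a) / (b + h - a) * a + h / (b + h - a) * (b + h) = a + h := by
    field_simp; ring
  have e2 : h / (b + h - a) * a + (b - a) / (b + h - a) * (b + h) = b := by
    field_simp; ring
  have e3 : (b - a) / (b + h - a) + h / (b + h - a) = 1 := by field_simp; ring
  rw [e1] at h1
  rw [e2] at h2
  have e4 : (b - a) / (b + h - a) = 1 - h / (b + h - a) := by linarith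
  rw [e4] at h1 h2
  linarith

lemma ConcaveOn.apply_add_le (hρ : ConcaveOn ℝ (Set.Ici 0) ρ) (h0 : ρ 0 = 0) {s t : ℝ}
    (hs : 0 < s) (ht : 0 ≤ t) : ρ (t + s) ≤ ρ s + t * (ρ s / s) := by
  have h1 := hρ.2 (Set.mem_Ici.2 le_rfl) (Set.mem_Ici.2 (by linarith : 0 ≤ t + s))
    (by positivity : 0 ≤ t / (t + s)) (by positivity : 0 ≤ s / (t + s)) (by field_simp)
  simp only [smul_eq_mul, h0, mul_zero, zero_add] at h1
  rw [div_mul_cancel₀ _ (by positivity)] at h1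
  have : ρ s + t * (ρ s / s) = (t + s) / s * ρ s := by field_simp; ring
  rw [this]
  calc ρ (t + s) = (t + s) / s * (s / (t + s) * ρ (t + s)) := by field_simp
    _ ≤ _ := by gcongr

lemma ConcaveOn.monotoneOn_of_nonneg (hρ : ConcaveOn ℝ (Set.Ici 0) ρ)
    (hn : ∀ t, 0 ≤ t → 0 ≤ ρ t) : MonotoneOn ρ (Set.Ici 0) := by
  intro x hx y hy hxy
  rw [Set.mem_Ici] at hx hy
  by_contra! hlt
  obtain ⟨h, hh, rfl⟩ : ∃ h, 0 ≤ h ∧ y = x + h := ⟨y - x, by linarith, by ring⟩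
  have key : ∀ n : ℕ, ρ (x + n * h) ≤ ρ x + n * (ρ (x + h) - ρ x) := by
    intro n
    induction n with
    | zero => simp
    | succ n ih =>
      have := hρ.add_sub_le_add_sub hx (b := x + n * h) (le_add_of_nonneg_right (by positivity)) hh
      push_cast
      rw [show x + (n + 1) * h = x + n * h + h by ring]
      linarith
  obtain ⟨n, hnn⟩ := exists_nat_gt (ρ x / (ρ x - ρ (x + h)))
  rw [div_lt_iff₀ (by linarith)] at hnn
  have h1 := hn (x + n * h) (by positivity)
  have h2 := key n
  linarith

/-- For a sublinear, unbounded, concave `ρ`, the shifted weights `e^{ρ(t+s)-ρ(s)}` are small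
compared with `e^{ρ(t)}`, up to a bounded contribution close to `1`. -/
lemma exists_shift_exp_le (hρ : ConcaveOn ℝ (Set.Ici 0) ρ) (h0 : ρ 0 = 0)
    (hn : ∀ t, 0 ≤ t → 0 ≤ ρ t) (hlin : ∀ η > 0, ∃ s > 0, ρ s ≤ η * s)
    (hub : ∀ B, ∃ s, 0 ≤ s ∧ B ≤ ρ s) {p ε : ℝ} (hp : 0 < p) (hε : 0 < ε) :
    ∃ s, 0 ≤ s ∧ ∀ t, 0 ≤ t →
      Real.exp (p * (ρ (t + s) - ρ s)) ≤ 1 + ε + ε * Real.exp (p * ρ t) := by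
  have hlin' : ∀ η > 0, ∃ s > 0, ∀ t ≥ s, ρ t ≤ η * t := by
    intro η hη
    obtain ⟨s, hs, hsη⟩ := hlin η hη
    refine ⟨s, hs, fun t ht => ?_⟩
    have := hρ.apply_add_le h0 hs (t := t - s) (by linarith)
    have h2 : ρ s / s ≤ η := by rwa [div_le_iff₀ hs]
    have h3 : (t - s) * (ρ s / s) ≤ (t - s) * η := by gcongr
    rw [sub_add_cancel] at this
    linarith
  obtain ⟨s₀, hs₀, hB⟩ := hub (1 - Real.log ε / p)
  have hs₀ε : Real.exp (p * (1 - ρ s₀)) ≤ ε := by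
    rw [← Real.le_log_iff_exp_le hε]
    have : p * (1 - ρ s₀) ≤ p * (Real.log ε / p) := by gcongr; linarith
    rwa [mul_div_cancel₀ _ hp.ne'] at this
  obtain ⟨t₀, ht₀, hη⟩ := hlin' (1 / (s₀ + 1)) (by positivity)
  have hlog : 0 < Real.log (1 + ε) := Real.log_pos (by linarith)
  obtain ⟨s₁, hs₁, hη₁⟩ := hlin' (Real.log (1 + ε) / (p * t₀)) (by positivity)
  refine ⟨max s₀ s₁, le_max_of_le_left hs₀, fun t ht => ?_⟩
  set s := max s₀ s₁
  have hs : 0 < s := lt_max_of_lt_right hs₁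
  rcases le_total t t₀ with htt | htt
  · have h1 := hρ.apply_add_le h0 hs ht
    have h2 : ρ s / s ≤ Real.log (1 + ε) / (p * t₀) := by
      rw [div_le_iff₀ hs]; exact hη₁ s (le_max_right _ _)
    have h3 : t * (ρ s / s) ≤ t₀ * (Real.log (1 + ε) / (p * t₀)) := by
      have := hn s hs.le
      gcongr
    have h4 : p * (ρ (t + s) - ρ s) ≤ Real.log (1 + ε) := by
      calc p * (ρ (t + s) - ρ s) ≤ p * (t₀ * (Real.log (1 + ε) / (p * t₀))) := by
            gcongr; linarith
        _ = _ := by field_simp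
    have h5 := Real.exp_le_exp.2 h4
    rw [Real.exp_log (by linarith)] at h5
    have : 0 ≤ ε * Real.exp (p * ρ t) := by positivity
    linarith
  · have htpos : 0 < t := ht₀.trans_le htt
    have h1 := hρ.apply_add_le h0 htpos hs₀
    have h2 : s₀ * (ρ t / t) ≤ 1 := by
      have : ρ t / t ≤ 1 / (s₀ + 1) := by rw [div_le_iff₀ htpos]; exact hη t htt
      calc s₀ * (ρ t / t) ≤ s₀ * (1 / (s₀ + 1)) := by gcongr
        _ ≤ 1 := by rw [mul_one_div, div_le_one (by positivity)]; linarith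
    have h3 := hρ.add_sub_le_add_sub hs₀ (le_max_left s₀ s₁ : s₀ ≤ s) ht
    rw [add_comm s t] at h3
    have h4 : p * (ρ (t + s) - ρ s) ≤ p * (1 - ρ s₀) + p * ρ t := by
      rw [← mul_add]; gcongr; linarith
    calc Real.exp (p * (ρ (t + s) - ρ s)) ≤ Real.exp (p * (1 - ρ s₀)) * Real.exp (p * ρ t) := by
          rw [← Real.exp_add]; exact Real.exp_le_exp.2 h4
      _ ≤ ε * Real.exp (p * ρ t) := by gcongr
      _ ≤ _ := by linarith

/-- The shifted function `t ↦ ρ(t+s) - ρ(s)` is subadditive. -/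
lemma ConcaveOn.shift_subadditive (hρ : ConcaveOn ℝ (Set.Ici 0) ρ) {s t t' : ℝ} (hs : 0 ≤ s)
    (ht : 0 ≤ t) (ht' : 0 ≤ t') :
    ρ (t + t' + s) - ρ s ≤ (ρ (t + s) - ρ s) + (ρ (t' + s) - ρ s) := by
  have := hρ.add_sub_le_add_sub hs (by linarith : s ≤ t + s) ht'
  rw [show t + t' + s = t + s + t' by ring, add_comm t' s]
  linarith

end ConcaveGrowth

section RowNorm

variable {ι : Type*} [DecidableEq ι]

/-- The matrix entry `⟨e_k, S e_l⟩` of a bounded operator on `ℓ²(ι)`. -/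
noncomputable def matrixEntry (S : lp (fun _ : ι => ℂ) 2 →L[ℂ] lp (fun _ : ι => ℂ) 2)
    (k l : ι) : ℂ :=
  S (lp.single 2 l (1 : ℂ)) k

lemma hasSum_matrixEntry_mul (S : lp (fun _ : ι => ℂ) 2 →L[ℂ] lp (fun _ : ι => ℂ) 2)
    (f : lp (fun _ : ι => ℂ) 2) (k : ι) :
    HasSum (fun l => matrixEntry S k l * f l) (S f k) := by
  have h := (lp.hasSum_single (p := 2) (by simp) f).mapL ((lp.evalCLM ℂ (fun _ : ι => ℂ) 2 k).comp S)
  convert! h using 2 with l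
  have : lp.single 2 l (f l) = f l • lp.single (E := fun _ : ι => ℂ) 2 l (1 : ℂ) := by
    rw [← lp.single_smul]; simp
  rw [this, map_smul, matrixEntry, smul_eq_mul, mul_comm]
  rfl

lemma matrixEntry_mul (S S' : lp (fun _ : ι => ℂ) 2 →L[ℂ] lp (fun _ : ι => ℂ) 2) (k l : ι) :
    matrixEntry (S * S') k l = ∑' j, matrixEntry S k j * matrixEntry S' j l :=
  (hasSum_matrixEntry_mul S _ k).tsum_eq.symm

lemma matrixEntry_one (k l : ι) :
    matrixEntry (1 : lp (fun _ : ι => ℂ) 2 →L[ℂ] lp (fun _ : ι => ℂ) 2) k l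
      = if k = l then 1 else 0 := by
  simp [matrixEntry, Pi.single_apply]

lemma norm_matrixEntry_le (S : lp (fun _ : ι => ℂ) 2 →L[ℂ] lp (fun _ : ι => ℂ) 2) (k l : ι) :
    ‖matrixEntry S k l‖ ≤ ‖S‖ := by
  refine (lp.norm_apply_le_norm (by simp) _ k).trans ((S.le_opNorm _).trans ?_)
  rw [lp.norm_single (by simp)]; simp

lemma matrixEntry_pow_hermitian {T : lp (fun _ : ι => ℂ) 2 →L[ℂ] lp (fun _ : ι => ℂ) 2}
    (hT : ∀ k l, matrixEntry T k l = starRingEnd ℂ (matrixEntry T l k)) (n : ℕ) (k l : ι) :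
    matrixEntry (T ^ n) k l = starRingEnd ℂ (matrixEntry (T ^ n) l k) := by
  induction n generalizing k l with
  | zero => simp [matrixEntry_one, eq_comm, apply_ite]
  | succ n ih =>
    rw [pow_succ', matrixEntry_mul, ← pow_succ', pow_succ, matrixEntry_mul, Complex.conj_tsum]
    refine tsum_congr fun j => ?_
    rw [hT k j, ih j l, map_mul, mul_comm]

lemma isSelfAdjoint_of_matrixEntry_hermitian
    {T : lp (fun _ : ι => ℂ) 2 →L[ℂ] lp (fun _ : ι => ℂ) 2}
    (hT : ∀ k l, matrixEntry T k l = starRingEnd ℂ (matrixEntry T l k)) : IsSelfAdjoint T := by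
  rw [ContinuousLinearMap.isSelfAdjoint_iff']
  ext f k
  have h1 : (ContinuousLinearMap.adjoint T f) k
      = inner ℂ (lp.single (E := fun _ : ι => ℂ) 2 k (1 : ℂ)) (ContinuousLinearMap.adjoint T f) := by
    rw [lp.inner_single_left]; simp
  rw [h1, ContinuousLinearMap.adjoint_inner_right, lp.inner_eq_tsum,
    ← (hasSum_matrixEntry_mul T f k).tsum_eq]
  refine tsum_congr fun l => ?_
  rw [hT k l, RCLike.inner_apply, mul_comm]
  rfl

lemma IsSelfAdjoint.norm_pow_eq {E : Type*} [NormedRing E] [StarRing E] [CStarRing E]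
    [NormOneClass E] {x : E} (hx : IsSelfAdjoint x) (n : ℕ) : ‖x ^ n‖ = ‖x‖ ^ n := by
  refine le_antisymm (norm_pow_le x n) ?_
  rcases (norm_nonneg x).eq_or_lt with h | h
  · rcases n.eq_zero_or_pos with rfl | hn
    · simp
    · rw [← h, zero_pow hn.ne']; positivity
  have hlt : n ≤ 2 ^ n := Nat.lt_two_pow_self.le
  obtain ⟨m, hm⟩ := Nat.exists_eq_add_of_le hlt
  have h1 := hx.norm_pow_two_pow n
  have h2 : ‖x‖ ^ n * ‖x‖ ^ m ≤ ‖x ^ n‖ * ‖x‖ ^ m := by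
    rw [← pow_add, ← hm, ← h1, hm, pow_add]
    exact (norm_mul_le _ _).trans (by gcongr; exact norm_pow_le _ _)
  exact le_of_mul_le_mul_right h2 (by positivity)

lemma ENNReal.rpow_tsum_le_tsum_rpow {α : Type*} {p : ℝ} (hp0 : 0 < p) (hp1 : p ≤ 1)
    (f : α → ℝ≥0∞) : (∑' a, f a) ^ p ≤ ∑' a, f a ^ p := by
  have hfin : ∀ s : Finset α, (∑ a ∈ s, f a) ^ p ≤ ∑ a ∈ s, f a ^ p := by
    intro s
    classical
    induction s using Finset.induction_on with
    | empty => simp [hp0]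
    | insert a s ha ih =>
      rw [Finset.sum_insert ha, Finset.sum_insert ha]
      exact (ENNReal.rpow_add_le_add_rpow _ _ hp0.le hp1).trans (by gcongr)
  refine le_of_tendsto
    ((ENNReal.continuous_rpow_const.tendsto _).comp ENNReal.summable.hasSum) ?_
  filter_upwards with s
  exact (hfin s).trans (ENNReal.sum_le_tsum s)

lemma enorm_matrixEntry_mul_rpow_le {p : ℝ} (hp0 : 0 < p) (hp1 : p ≤ 1)
    (S S' : lp (fun _ : ι => ℂ) 2 →L[ℂ] lp (fun _ : ι => ℂ) 2) (k l : ι) :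
    ‖matrixEntry (S * S') k l‖ₑ ^ p
      ≤ ∑' j, ‖matrixEntry S k j‖ₑ ^ p * ‖matrixEntry S' j l‖ₑ ^ p := by
  rw [matrixEntry_mul]
  calc ‖∑' j, matrixEntry S k j * matrixEntry S' j l‖ₑ ^ p
      ≤ (∑' j, ‖matrixEntry S k j * matrixEntry S' j l‖ₑ) ^ p := by
        gcongr; exact enorm_tsum_le_tsum_enorm
    _ ≤ ∑' j, ‖matrixEntry S k j * matrixEntry S' j l‖ₑ ^ p :=
        ENNReal.rpow_tsum_le_tsum_rpow hp0 hp1 _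
    _ = _ := by
        simp only [enorm_mul, ENNReal.mul_rpow_of_nonneg _ _ hp0.le]

variable [AddCommGroup ι]

/-- `sup_k Σ_l |⟨e_k, S e_l⟩|^p w(k-l)`. -/
noncomputable def rowNorm (p : ℝ) (w : ι → ℝ≥0∞)
    (S : lp (fun _ : ι => ℂ) 2 →L[ℂ] lp (fun _ : ι => ℂ) 2) : ℝ≥0∞ :=
  ⨆ k, ∑' l, ‖matrixEntry S k l‖ₑ ^ p * w (k - l)

lemma tsum_le_rowNorm (p : ℝ) (w : ι → ℝ≥0∞)
    (S : lp (fun _ : ι => ℂ) 2 →L[ℂ] lp (fun _ : ι => ℂ) 2) (k : ι) :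
    ∑' l, ‖matrixEntry S k l‖ₑ ^ p * w (k - l) ≤ rowNorm p w S :=
  le_iSup (fun k => ∑' l, ‖matrixEntry S k l‖ₑ ^ p * w (k - l)) k

lemma rowNorm_mono {p : ℝ} {w w' : ι → ℝ≥0∞} (h : ∀ x, w x ≤ w' x)
    (S : lp (fun _ : ι => ℂ) 2 →L[ℂ] lp (fun _ : ι => ℂ) 2) :
    rowNorm p w S ≤ rowNorm p w' S := by
  unfold rowNorm; gcongr; exact h _

lemma rowNorm_add_le {p : ℝ} (w w' : ι → ℝ≥0∞)
    (S : lp (fun _ : ι => ℂ) 2 →L[ℂ] lp (fun _ : ι => ℂ) 2) :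
    rowNorm p (w + w') S ≤ rowNorm p w S + rowNorm p w' S := by
  refine iSup_le fun k => ?_
  simp only [Pi.add_apply, mul_add, ENNReal.tsum_add]
  gcongr <;> exact tsum_le_rowNorm ..

lemma rowNorm_smul (p : ℝ) (c : ℝ≥0∞) (w : ι → ℝ≥0∞)
    (S : lp (fun _ : ι => ℂ) 2 →L[ℂ] lp (fun _ : ι => ℂ) 2) :
    rowNorm p (fun x => c * w x) S = c * rowNorm p w S := by
  simp only [rowNorm, mul_left_comm _ c, ENNReal.tsum_mul_left, ENNReal.mul_iSup]

lemma rowNorm_one_le {p : ℝ} (hp : 0 < p) (w : ι → ℝ≥0∞) : rowNorm p w 1 ≤ w 0 := by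
  refine iSup_le fun k => ?_
  rw [tsum_eq_single k]
  · simp [matrixEntry_one]
  · intro l hl
    simp [matrixEntry_one, hl.symm, hp]

lemma tsum_mul_weight_le_rowNorm_mul (p : ℝ) (u v : ι → ℝ≥0∞)
    (S S' : lp (fun _ : ι => ℂ) 2 →L[ℂ] lp (fun _ : ι => ℂ) 2) (k : ι) :
    ∑' l, ∑' j, ‖matrixEntry S k j‖ₑ ^ p * ‖matrixEntry S' j l‖ₑ ^ p * (u (k - j) * v (j - l))
      ≤ rowNorm p u S * rowNorm p v S' := by
  rw [ENNReal.tsum_comm]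
  calc ∑' j, ∑' l, ‖matrixEntry S k j‖ₑ ^ p * ‖matrixEntry S' j l‖ₑ ^ p * (u (k - j) * v (j - l))
      = ∑' j, ‖matrixEntry S k j‖ₑ ^ p * u (k - j) *
          ∑' l, ‖matrixEntry S' j l‖ₑ ^ p * v (j - l) := by
        refine tsum_congr fun j => ?_
        rw [← ENNReal.tsum_mul_left]
        exact tsum_congr fun l => mul_mul_mul_comm ..
    _ ≤ ∑' j, ‖matrixEntry S k j‖ₑ ^ p * u (k - j) * rowNorm p v S' := by
        gcongr; exact tsum_le_rowNorm ..
    _ ≤ _ := by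
        rw [ENNReal.tsum_mul_right]; gcongr; exact tsum_le_rowNorm ..

lemma rowNorm_mul_le {p : ℝ} (hp0 : 0 < p) (hp1 : p ≤ 1) {w : ι → ℝ≥0∞}
    (hw : ∀ x y, w (x + y) ≤ w x * w y)
    (S S' : lp (fun _ : ι => ℂ) 2 →L[ℂ] lp (fun _ : ι => ℂ) 2) :
    rowNorm p w (S * S') ≤ rowNorm p w S * rowNorm p w S' := by
  refine iSup_le fun k => le_trans ?_ (tsum_mul_weight_le_rowNorm_mul p w w S S' k)
  gcongr with l
  refine (mul_le_mul_left (enorm_matrixEntry_mul_rpow_le hp0 hp1 S S' k l) _).trans ?_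
  rw [← ENNReal.tsum_mul_right]
  gcongr with j
  rw [← sub_add_sub_cancel k j l]
  exact hw _ _

lemma rowNorm_mul_le_of_subadditive {p : ℝ} (hp0 : 0 < p) (hp1 : p ≤ 1) {w : ι → ℝ≥0∞}
    (hw : ∀ x y, w (x + y) ≤ w x + w y)
    (S S' : lp (fun _ : ι => ℂ) 2 →L[ℂ] lp (fun _ : ι => ℂ) 2) :
    rowNorm p w (S * S')
      ≤ rowNorm p w S * rowNorm p (fun _ => 1) S' + rowNorm p (fun _ => 1) S * rowNorm p w S' := by
  refine iSup_le fun k => le_trans ?_ (add_le_add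
    (tsum_mul_weight_le_rowNorm_mul p w (fun _ => 1) S S' k)
    (tsum_mul_weight_le_rowNorm_mul p (fun _ => 1) w S S' k))
  rw [← ENNReal.tsum_add]
  gcongr with l
  refine (mul_le_mul_left (enorm_matrixEntry_mul_rpow_le hp0 hp1 S S' k l) _).trans ?_
  rw [← ENNReal.tsum_mul_right, ← ENNReal.tsum_add]
  gcongr with j
  rw [← mul_add, mul_one, one_mul, ← sub_add_sub_cancel k j l]
  gcongr
  exact hw _ _

lemma rowNorm_pow_le {p : ℝ} (hp0 : 0 < p) (hp1 : p ≤ 1) {w : ι → ℝ≥0∞}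
    (hw : ∀ x y, w (x + y) ≤ w x * w y) (hw0 : w 0 ≤ 1)
    (S : lp (fun _ : ι => ℂ) 2 →L[ℂ] lp (fun _ : ι => ℂ) 2) (n : ℕ) :
    rowNorm p w (S ^ n) ≤ rowNorm p w S ^ n := by
  induction n with
  | zero => simpa using (rowNorm_one_le hp0 w).trans hw0
  | succ n ih =>
    rw [pow_succ, pow_succ]
    exact (rowNorm_mul_le hp0 hp1 hw _ _).trans (by gcongr)

/-- If some power of `S` has row norm below `μ ^ k`, all powers grow at most like `μ ^ n`. -/
lemma exists_rowNorm_pow_le {p : ℝ} (hp0 : 0 < p) (hp1 : p ≤ 1) {w : ι → ℝ≥0∞}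
    (hw : ∀ x y, w (x + y) ≤ w x * w y) (hw0 : w 0 ≤ 1)
    {S : lp (fun _ : ι => ℂ) 2 →L[ℂ] lp (fun _ : ι => ℂ) 2} (hS : rowNorm p w S ≠ ⊤)
    {μ : ℝ≥0∞} (hμ0 : μ ≠ 0) (hμ : μ ≠ ⊤) {k : ℕ} (hk : 0 < k)
    (hle : rowNorm p w (S ^ k) ≤ μ ^ k) :
    ∃ K : ℝ≥0∞, K ≠ ⊤ ∧ ∀ n, rowNorm p w (S ^ n) ≤ K * μ ^ n := by
  refine ⟨∑ r ∈ Finset.range k, rowNorm p w (S ^ r) / μ ^ r, ?_, fun n => ?_⟩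
  · refine ENNReal.sum_ne_top.2 fun r _ => ENNReal.div_ne_top ?_ (pow_ne_zero _ hμ0)
    exact ne_top_of_le_ne_top (ENNReal.pow_ne_top hS) (rowNorm_pow_le hp0 hp1 hw hw0 S r)
  · have h1 : rowNorm p w (S ^ (n % k)) / μ ^ (n % k)
        ≤ ∑ r ∈ Finset.range k, rowNorm p w (S ^ r) / μ ^ r :=
      Finset.single_le_sum (f := fun r => rowNorm p w (S ^ r) / μ ^ r) (fun _ _ => zero_le)
        (Finset.mem_range.2 (Nat.mod_lt n hk))
    calc rowNorm p w (S ^ n) = rowNorm p w ((S ^ k) ^ (n / k) * S ^ (n % k)) := by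
          rw [← pow_mul, ← pow_add, Nat.div_add_mod]
      _ ≤ rowNorm p w ((S ^ k) ^ (n / k)) * rowNorm p w (S ^ (n % k)) :=
          rowNorm_mul_le hp0 hp1 hw _ _
      _ ≤ (μ ^ k) ^ (n / k) * rowNorm p w (S ^ (n % k)) := by
          gcongr
          exact (rowNorm_pow_le hp0 hp1 hw hw0 _ _).trans (by gcongr)
      _ = (rowNorm p w (S ^ (n % k)) / μ ^ (n % k)) * ((μ ^ k) ^ (n / k) * μ ^ (n % k)) := by
          rw [mul_comm _ (μ ^ (n % k)), ← mul_assoc,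
            ENNReal.div_mul_cancel (pow_ne_zero _ hμ0) (ENNReal.pow_ne_top hμ), mul_comm]
      _ = (rowNorm p w (S ^ (n % k)) / μ ^ (n % k)) * μ ^ n := by
          rw [← pow_mul, ← pow_add, Nat.div_add_mod]
      _ ≤ _ := by gcongr

end RowNorm

section SchurTest

variable {ι : Type*}

lemma lp.nontrivial_of_nonempty [Nonempty ι] : Nontrivial (lp (fun _ : ι => ℂ) 2) := by
  classical
  obtain ⟨i⟩ := ‹Nonempty ι›
  refine ⟨⟨lp.single 2 i (1 : ℂ), 0, fun h => ?_⟩⟩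
  simpa using congrArg (fun f : lp (fun _ : ι => ℂ) 2 => f i) h

lemma lp.enorm_sq_eq_tsum (f : lp (fun _ : ι => ℂ) 2) : ‖f‖ₑ ^ 2 = ∑' k, ‖f k‖ₑ ^ 2 := by
  have h := lp.hasSum_norm (p := 2) (by simp) f
  simp only [ENNReal.toReal_ofNat, Real.rpow_ofNat] at h
  have h2 := ENNReal.ofReal_tsum_of_nonneg (fun k => by positivity) h.summable
  rw [h.tsum_eq] at h2
  simpa only [ENNReal.ofReal_pow (norm_nonneg _), ofReal_norm] using h2

variable [DecidableEq ι]

/-- Schur's test for a Hermitian matrix. -/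
lemma opNorm_le_of_tsum_enorm_le {B : lp (fun _ : ι => ℂ) 2 →L[ℂ] lp (fun _ : ι => ℂ) 2}
    (hB : ∀ k l, matrixEntry B k l = starRingEnd ℂ (matrixEntry B l k)) {c : ℝ} (hc : 0 < c)
    (hle : ∀ k, ∑' l, ‖matrixEntry B k l‖ₑ ≤ ENNReal.ofReal c) : ‖B‖ ≤ c := by
  refine B.opNorm_le_bound hc.le fun f => ?_
  have hcol : ∀ l, ∑' k, ‖matrixEntry B k l‖ₑ ≤ ENNReal.ofReal c := by
    intro l
    convert hle l using 3 with k
    rw [hB k l, RCLike.enorm_conj]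
  have amgm : ∀ a b : ℝ≥0∞, 2 * (a * b) ≤ a ^ 2 + b ^ 2 := by
    intro a b
    rcases eq_or_ne a ⊤ with rfl | ha
    · simp
    rcases eq_or_ne b ⊤ with rfl | hb
    · simp
    lift a to ℝ≥0 using ha
    lift b to ℝ≥0 using hb
    norm_cast
    rw [← mul_assoc]
    exact two_mul_le_add_sq a b
  set C := ENNReal.ofReal c
  have hC0 : C ≠ 0 := by simpa [C] using hc
  have hCt : C ≠ ⊤ := ENNReal.ofReal_ne_top
  set g := B f
  have h1 : ‖g‖ₑ ^ 2 ≤ ∑' k, ∑' l, ‖matrixEntry B k l‖ₑ * (‖g k‖ₑ * ‖f l‖ₑ) := by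
    rw [lp.enorm_sq_eq_tsum]
    gcongr with k
    calc ‖g k‖ₑ ^ 2 = ‖g k‖ₑ * ‖∑' l, matrixEntry B k l * f l‖ₑ := by
          rw [(hasSum_matrixEntry_mul B f k).tsum_eq, sq]
      _ ≤ ‖g k‖ₑ * ∑' l, ‖matrixEntry B k l * f l‖ₑ := by
          gcongr; exact enorm_tsum_le_tsum_enorm
      _ = _ := by
          rw [← ENNReal.tsum_mul_left]
          refine tsum_congr fun l => ?_
          rw [enorm_mul]; ring
  have h2 : C * (2 * ‖g‖ₑ ^ 2) ≤ C * (‖g‖ₑ ^ 2 + C ^ 2 * ‖f‖ₑ ^ 2) := by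
    calc C * (2 * ‖g‖ₑ ^ 2)
        ≤ C * (2 * ∑' k, ∑' l, ‖matrixEntry B k l‖ₑ * (‖g k‖ₑ * ‖f l‖ₑ)) := by gcongr
      _ = ∑' k, ∑' l, ‖matrixEntry B k l‖ₑ * (2 * (‖g k‖ₑ * (C * ‖f l‖ₑ))) := by
          simp only [← ENNReal.tsum_mul_left]
          refine tsum_congr fun k => tsum_congr fun l => ?_
          ring
      _ ≤ ∑' k, ∑' l, ‖matrixEntry B k l‖ₑ * (‖g k‖ₑ ^ 2 + (C * ‖f l‖ₑ) ^ 2) := by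
          gcongr; exact amgm _ _
      _ = ∑' k, (∑' l, ‖matrixEntry B k l‖ₑ) * ‖g k‖ₑ ^ 2
          + ∑' l, (∑' k, ‖matrixEntry B k l‖ₑ) * (C ^ 2 * ‖f l‖ₑ ^ 2) := by
          simp only [mul_add, ENNReal.tsum_add, ← ENNReal.tsum_mul_right, mul_pow]
          congr 1
          exact ENNReal.tsum_comm
      _ ≤ ∑' k, C * ‖g k‖ₑ ^ 2 + ∑' l, C * (C ^ 2 * ‖f l‖ₑ ^ 2) := by
          gcongr
          · exact hle _
          · exact hcol _
      _ = _ := by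
          rw [lp.enorm_sq_eq_tsum g, lp.enorm_sq_eq_tsum f]
          simp only [ENNReal.tsum_mul_left, mul_add]
  rw [ENNReal.mul_le_mul_iff_right hC0 hCt, two_mul] at h2
  have h3 := (ENNReal.add_le_add_iff_left (ENNReal.pow_ne_top enorm_ne_top)).1 h2
  rw [← mul_pow] at h3
  have h4 := (ENNReal.pow_le_pow_left_iff two_ne_zero).1 h3
  rw [← ofReal_norm, ← ofReal_norm, ← ENNReal.ofReal_mul hc.le] at h4
  exact (ENNReal.ofReal_le_ofReal_iff (by positivity)).1 h4

lemma ofReal_opNorm_rpow_le_rowNorm [AddCommGroup ι] {p : ℝ} (hp0 : 0 < p) (hp1 : p ≤ 1)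
    {B : lp (fun _ : ι => ℂ) 2 →L[ℂ] lp (fun _ : ι => ℂ) 2}
    (hB : ∀ k l, matrixEntry B k l = starRingEnd ℂ (matrixEntry B l k)) :
    ENNReal.ofReal (‖B‖ ^ p) ≤ rowNorm p (fun _ => 1) B := by
  rw [← ENNReal.ofReal_rpow_of_nonneg (norm_nonneg _) hp0.le,
    ← ENNReal.le_rpow_inv_iff hp0]
  by_contra! hlt
  obtain ⟨c, -, h1, h2⟩ := ENNReal.lt_iff_exists_real_btwn.1 hlt
  have hc : 0 < c := ENNReal.ofReal_pos.1 (bot_le.trans_lt h1)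
  refine absurd (opNorm_le_of_tsum_enorm_le hB hc fun k => ?_)
    (not_le.2 ((ENNReal.ofReal_lt_ofReal_iff_of_nonneg hc.le).1 h2))
  refine le_trans ?_ h1.le
  rw [ENNReal.le_rpow_inv_iff hp0]
  refine (ENNReal.rpow_tsum_le_tsum_rpow hp0 hp1 _).trans ?_
  simpa using tsum_le_rowNorm p (fun _ => 1) B k

end SchurTest

section PolynomialWeight

variable {d : ℕ}

/-- The row norm without weight is controlled by the entries close to the diagonal and, for the
remaining ones, by the row norm with a polynomial weight. -/
lemma rowNorm_le_add_of_one_le {p γ r : ℝ} (hγ : 0 < γ) (hr : 1 ≤ r) {μ : ℝ≥0∞}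
    {B : lp (fun _ : Fin d → ℤ => ℂ) 2 →L[ℂ] lp (fun _ : Fin d → ℤ => ℂ) 2}
    (hB : ∀ k l, ‖matrixEntry B k l‖ₑ ^ p ≤ μ) :
    rowNorm p (fun _ => 1) B ≤ ENNReal.ofReal ((3 * r) ^ d) * μ
      + ENNReal.ofReal (r ^ (-γ)) * rowNorm p (fun x => ENNReal.ofReal ((1 + ‖x‖) ^ γ)) B := by
  refine iSup_le fun k => ?_
  set F : Finset (Fin d → ℤ) := Fintype.piFinset fun i => Finset.Icc (k i - ⌊r⌋) (k i + ⌊r⌋)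
  have hF : ∀ l, l ∉ F → r ≤ 1 + ‖k - l‖ := by
    intro l hl
    by_contra! hlt
    refine hl (Fintype.mem_piFinset.2 fun i => ?_)
    have h1 : ‖(k - l) i‖ ≤ r := (norm_le_pi_norm (k - l) i).trans (by linarith)
    rw [Int.norm_eq_abs, ← Int.cast_abs, ← Int.le_floor, abs_le] at h1
    simp only [Pi.sub_apply] at h1
    rw [Finset.mem_Icc]
    constructor <;> linarith [h1.1, h1.2]
  have hcard : (F.card : ℝ≥0∞) ≤ ENNReal.ofReal ((3 * r) ^ d) := by
    rw [← ENNReal.ofReal_natCast]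
    refine ENNReal.ofReal_le_ofReal ?_
    have hfl : 0 ≤ ⌊r⌋ := Int.floor_nonneg.2 (by linarith)
    have : F.card = (2 * ⌊r⌋ + 1).toNat ^ d := by
      simp only [F, Fintype.card_piFinset, Int.card_Icc]
      rw [Finset.prod_congr rfl (g := fun _ => (2 * ⌊r⌋ + 1).toNat) (by intro i _; congr 1; ring)]
      simp
    rw [this, Nat.cast_pow]
    gcongr
    have h2 : (((2 * ⌊r⌋ + 1).toNat : ℤ) : ℝ) = 2 * ⌊r⌋ + 1 := by
      rw [Int.toNat_of_nonneg (by omega)]; push_cast; ring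
    rw [Int.cast_natCast] at h2
    rw [h2]
    linarith [Int.floor_le r]
  calc ∑' l, ‖matrixEntry B k l‖ₑ ^ p * 1
      ≤ ∑' l, ((F : Set (Fin d → ℤ)).indicator (fun _ => μ) l + ENNReal.ofReal (r ^ (-γ)) *
          (‖matrixEntry B k l‖ₑ ^ p * ENNReal.ofReal ((1 + ‖k - l‖) ^ γ))) := by
        gcongr with l
        by_cases hl : l ∈ F
        · rw [Set.indicator_of_mem (Finset.mem_coe.2 hl), mul_one]
          exact le_add_right (hB k l)
        · rw [mul_left_comm, ← ENNReal.ofReal_mul (by positivity)]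
          refine le_add_left ?_
          gcongr
          rw [ENNReal.one_le_ofReal, Real.rpow_neg (by linarith), inv_mul_eq_div,
            one_le_div (by positivity)]
          gcongr
          exact hF l hl
    _ = F.card * μ + ENNReal.ofReal (r ^ (-γ)) *
          ∑' l, ‖matrixEntry B k l‖ₑ ^ p * ENNReal.ofReal ((1 + ‖k - l‖) ^ γ) := by
        rw [ENNReal.tsum_add, ENNReal.tsum_mul_left, ← sum_eq_tsum_indicator]
        simp
    _ ≤ _ := by
        gcongr
        exact tsum_le_rowNorm p (fun x => ENNReal.ofReal ((1 + ‖x‖) ^ γ)) B k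

/-- Interpolation of the row norm between the entrywise bound and the weighted row norm. -/
lemma rowNorm_le_interpolate {p γ σ : ℝ} (hγ : 0 < γ) (hσ : 1 ≤ σ) {μ : ℝ≥0∞}
    {B : lp (fun _ : Fin d → ℤ => ℂ) 2 →L[ℂ] lp (fun _ : Fin d → ℤ => ℂ) 2}
    (hB : ∀ k l, ‖matrixEntry B k l‖ₑ ^ p ≤ μ)
    (hBσ : rowNorm p (fun x => ENNReal.ofReal ((1 + ‖x‖) ^ γ)) B ≤ ENNReal.ofReal σ * μ) :
    rowNorm p (fun _ => 1) B
      ≤ ENNReal.ofReal ((3 ^ d + 1) * σ ^ (((d : ℝ) + 1) / (d + 1 + γ))) * μ := by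
  set r : ℝ := σ ^ (1 / ((d : ℝ) + 1 + γ)) with hr
  have hσ0 : 0 < σ := by linarith
  have hr1 : 1 ≤ r := Real.one_le_rpow hσ (by positivity)
  have e1 : r ^ d ≤ σ ^ (((d : ℝ) + 1) / (d + 1 + γ)) := by
    rw [hr, ← Real.rpow_natCast, ← Real.rpow_mul hσ0.le]
    refine Real.rpow_le_rpow_of_exponent_le hσ ?_
    rw [div_mul_eq_mul_div, one_mul]
    gcongr
    linarith
  have e2 : r ^ (-γ) * σ = σ ^ (((d : ℝ) + 1) / (d + 1 + γ)) := by
    rw [hr, ← Real.rpow_mul hσ0.le]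
    nth_rewrite 2 [← Real.rpow_one σ]
    rw [← Real.rpow_add hσ0]
    congr 1
    field_simp
    ring
  refine (rowNorm_le_add_of_one_le hγ hr1 hB).trans ?_
  calc _ ≤ ENNReal.ofReal ((3 * r) ^ d) * μ
        + ENNReal.ofReal (r ^ (-γ)) * (ENNReal.ofReal σ * μ) := by gcongr
    _ = ENNReal.ofReal ((3 * r) ^ d + r ^ (-γ) * σ) * μ := by
        rw [ENNReal.ofReal_add (by positivity) (by positivity), add_mul,
          ENNReal.ofReal_mul (p := r ^ (-γ)) (by positivity), mul_assoc]
    _ ≤ _ := by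
        gcongr
        rw [e2, mul_pow, add_mul, one_mul]
        gcongr

lemma exists_mul_rpow_lt_pow {C K a q : ℝ} (hC : 0 < C) (hK : 0 < K) (ha : 1 < a) (hq0 : 0 ≤ q)
    (hq : q < 2) : ∃ m : ℕ, C * K ^ (q ^ m) < a ^ (2 ^ m) := by
  have h1 : Tendsto (fun m : ℕ => Real.log C * (1 / 2 : ℝ) ^ m + Real.log K * (q / 2) ^ m)
      atTop (nhds (Real.log C * 0 + Real.log K * 0)) :=
    ((tendsto_pow_atTop_nhds_zero_of_lt_one (by norm_num) (by norm_num)).const_mul _).add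
      ((tendsto_pow_atTop_nhds_zero_of_lt_one (by positivity) (by linarith)).const_mul _)
  rw [mul_zero, mul_zero, add_zero] at h1
  obtain ⟨m, hm⟩ := (h1.eventually_lt_const (Real.log_pos ha)).exists
  refine ⟨m, ?_⟩
  rw [← Real.log_lt_log_iff (by positivity) (by positivity), Real.log_mul (by positivity)
    (by positivity), Real.log_rpow hK, Real.log_pow]
  have : Real.log C + q ^ m * Real.log K
      = 2 ^ m * (Real.log C * (1 / 2 : ℝ) ^ m + Real.log K * (q / 2) ^ m) := by
    rw [div_pow, div_pow, one_pow]; field_simp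
  rw [this]
  push_cast
  gcongr

/-- For polynomially weighted operators, the growth of the unweighted row norms of powers is
governed by the operator norm. -/
lemma exists_rowNorm_pow_lt {p γ : ℝ} (hp0 : 0 < p) (hp1 : p ≤ 1) (hγ : 0 < γ) (hγ1 : γ ≤ 1)
    {T : lp (fun _ : Fin d → ℤ => ℂ) 2 →L[ℂ] lp (fun _ : Fin d → ℤ => ℂ) 2}
    (hT : rowNorm p (fun x => ENNReal.ofReal ((1 + ‖x‖) ^ γ)) T ≠ ⊤) {μ : ℝ}
    (hμ : ‖T‖ ^ p < μ) :
    ∃ k : ℕ, 0 < k ∧ rowNorm p (fun _ => 1) (T ^ k) < ENNReal.ofReal μ ^ k := by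
  obtain ⟨μ₀, hTμ, hμ₀⟩ := exists_between hμ
  have hμ₀pos : 0 < μ₀ := (by positivity : 0 ≤ ‖T‖ ^ p).trans_lt hTμ
  set v : (Fin d → ℤ) → ℝ≥0∞ := fun x => ENNReal.ofReal ((1 + ‖x‖) ^ γ)
  have hv : ∀ x y, v (x + y) ≤ v x + v y := by
    intro x y
    rw [← ENNReal.ofReal_add (by positivity) (by positivity)]
    refine ENNReal.ofReal_le_ofReal (le_trans ?_
      (Real.rpow_add_le_add_rpow (by positivity) (by positivity) hγ.le hγ1))
    exact Real.rpow_le_rpow (by positivity) (by linarith [norm_add_le x y]) hγ.le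
  set M := ENNReal.ofReal μ₀
  have hM0 : M ≠ 0 := by simpa [M] using hμ₀pos
  have hMt : M ≠ ⊤ := ENNReal.ofReal_ne_top
  have hentry : ∀ n k l, ‖matrixEntry (T ^ n) k l‖ₑ ^ p ≤ M ^ n := by
    intro n k l
    rw [← ofReal_norm, ENNReal.ofReal_rpow_of_nonneg (norm_nonneg _) hp0.le,
      ← ENNReal.ofReal_pow hμ₀pos.le]
    refine ENNReal.ofReal_le_ofReal ?_
    calc ‖matrixEntry (T ^ n) k l‖ ^ p ≤ (‖T‖ ^ n) ^ p := by
          gcongr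
          have := lp.nontrivial_of_nonempty (ι := Fin d → ℤ)
          exact (norm_matrixEntry_le _ k l).trans (norm_pow_le T n)
      _ = (‖T‖ ^ p) ^ n := by
          rw [← Real.rpow_natCast, ← Real.rpow_mul (norm_nonneg _), mul_comm,
            Real.rpow_mul (norm_nonneg _), Real.rpow_natCast]
      _ ≤ μ₀ ^ n := by gcongr
  set C : ℝ := 3 ^ d + 1
  have hC : 1 ≤ C := by simp only [C]; linarith [pow_pos (show (0 : ℝ) < 3 by norm_num) d]
  set θ : ℝ := ((d : ℝ) + 1) / (d + 1 + γ)
  have hθ0 : 0 < θ := by positivity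
  have hθ1 : θ < 1 := by rw [div_lt_one (by positivity)]; linarith
  set σ₀ : ℝ := max 1 (rowNorm p v T / M).toReal
  have hσ₀ : rowNorm p v T ≤ ENNReal.ofReal σ₀ * M := by
    rw [← ENNReal.div_le_iff hM0 hMt]
    refine (ENNReal.le_ofReal_iff_toReal_le (ENNReal.div_ne_top hT hM0) ?_).2 (le_max_right _ _)
    exact zero_le_one.trans (le_max_left _ _)
  set D : ℝ := (2 * C) ^ (1 / θ)
  have hD1 : 1 ≤ D := Real.one_le_rpow (by linarith) (by positivity)
  have hDθ : D ^ θ = 2 * C := by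
    rw [← Real.rpow_mul (by positivity), one_div_mul_cancel hθ0.ne', Real.rpow_one]
  set K : ℝ := D * σ₀
  have hDK : D ≤ K := le_mul_of_one_le_right (by linarith) (le_max_left _ _)
  have hK1 : 1 ≤ K := hD1.trans hDK
  have hKD : ∀ m : ℕ, 1 ≤ K ^ ((1 + θ) ^ m) / D := by
    intro m
    rw [one_le_div (by linarith)]
    refine hDK.trans (Real.self_le_rpow_of_one_le hK1 ?_)
    exact one_le_pow₀ (by linarith)
  have main : ∀ m : ℕ,
      rowNorm p v (T ^ 2 ^ m) ≤ ENNReal.ofReal (K ^ ((1 + θ) ^ m) / D) * M ^ 2 ^ m := by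
    intro m
    induction m with
    | zero =>
      have : K / D = σ₀ := mul_div_cancel_left₀ _ (by linarith)
      simpa [this] using hσ₀
    | succ m ih =>
      have h1 := rowNorm_le_interpolate hγ (hKD m) (hentry _) ih
      set σ := K ^ ((1 + θ) ^ m) / D with hσ
      have hσ1 : 0 < σ := zero_lt_one.trans_le (hKD m)
      have e : K ^ ((1 + θ) ^ (m + 1)) / D = σ * (C * σ ^ θ) + C * σ ^ θ * σ := by
        have : σ ^ θ = K ^ ((1 + θ) ^ m * θ) / (2 * C) := by
          rw [hσ, Real.div_rpow (by positivity) (by positivity), hDθ,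
            ← Real.rpow_mul (by positivity)]
        rw [this, hσ, pow_succ, mul_add, mul_one, Real.rpow_add (by positivity)]
        field_simp
        ring
      calc rowNorm p v (T ^ 2 ^ (m + 1)) = rowNorm p v (T ^ 2 ^ m * T ^ 2 ^ m) := by
            rw [← pow_add]; congr 2; ring
        _ ≤ _ := rowNorm_mul_le_of_subadditive hp0 hp1 hv _ _
        _ ≤ (ENNReal.ofReal σ * M ^ 2 ^ m) * (ENNReal.ofReal (C * σ ^ θ) * M ^ 2 ^ m)
            + (ENNReal.ofReal (C * σ ^ θ) * M ^ 2 ^ m) * (ENNReal.ofReal σ * M ^ 2 ^ m) := by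
            gcongr
        _ = _ := by
            rw [e, ENNReal.ofReal_add (by positivity) (by positivity),
              ENNReal.ofReal_mul (p := σ) (by positivity),
              ENNReal.ofReal_mul (q := σ) (by positivity), pow_succ, pow_mul]
            ring
  obtain ⟨m, hm⟩ := exists_mul_rpow_lt_pow (C := C) (K := K) (a := μ / μ₀) (q := 1 + θ)
    (by linarith) (by linarith) (by rwa [one_lt_div hμ₀pos]) (by linarith) (by linarith)
  refine ⟨2 ^ m, by positivity, ?_⟩
  refine (rowNorm_le_interpolate hγ (hKD m) (hentry _) (main m)).trans_lt ?_
  have h1 := hKD m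
  rw [← ENNReal.ofReal_pow hμ₀pos.le, ← ENNReal.ofReal_pow (by linarith),
    ← ENNReal.ofReal_mul (by positivity),
    ENNReal.ofReal_lt_ofReal_iff_of_nonneg (by positivity)]
  calc C * (K ^ ((1 + θ) ^ m) / D) ^ θ * μ₀ ^ 2 ^ m
      ≤ C * K ^ ((1 + θ) ^ m) * μ₀ ^ 2 ^ m := by
        gcongr
        refine (Real.rpow_le_self_of_one_le h1 hθ1.le).trans ?_
        exact div_le_self (by positivity) hD1
    _ < (μ / μ₀) ^ 2 ^ m * μ₀ ^ 2 ^ m := by gcongr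
    _ = μ ^ 2 ^ m := by rw [← mul_pow, div_mul_cancel₀ _ hμ₀pos.ne']

end PolynomialWeight

section AdmissibleWeight

variable {d : ℕ}

/-- An admissible weight of weak growth can be replaced by an equivalent submultiplicative weight
that is nearly dominated by a constant close to `1`. -/
lemma IsAdmissibleWeight.exists_equivalent_weight {ω : (Fin d → ℝ) → ℝ}
    (hadm : IsAdmissibleWeight ω) (hwg : WeakGrowth ω) {p ε : ℝ} (hp : 0 < p) (hε : 0 < ε) :
    ∃ w : (Fin d → ℤ) → ℝ≥0∞, (∀ x y, w (x + y) ≤ w x * w y) ∧ w 0 ≤ 1 ∧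
      (∃ C : ℝ≥0∞, C ≠ ⊤ ∧ ∀ x, ENNReal.ofReal (ω (zr x)) ^ p ≤ C * w x) ∧
      ∀ x, w x ≤ ENNReal.ofReal (1 + ε) + ENNReal.ofReal ε * ENNReal.ofReal (ω (zr x)) ^ p := by
  obtain ⟨⟨N, ρ, hN, hN0, hNadd, hNsmul, -, hρ, h0, hn, hω⟩, hgrs⟩ := hadm
  obtain ⟨C, hC, δ, hδ, -, hCδ⟩ := hwg
  have hNzero : N 0 = 0 := (hN0 0).2 rfl
  have hW : ∀ x : Fin d → ℝ, ENNReal.ofReal (ω x) ^ p = ENNReal.ofReal (Real.exp (p * ρ (N x))) := by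
    intro x
    rw [hω, ENNReal.ofReal_rpow_of_nonneg (Real.exp_nonneg _) hp.le, ← Real.exp_mul, mul_comm]
  rcases d.eq_zero_or_pos with rfl | hd
  · refine ⟨fun _ => 1, by simp, le_rfl, ⟨1, by simp, fun x => ?_⟩, fun x => ?_⟩
    · rw [hW, Subsingleton.elim (zr x) 0, hNzero, h0]; simp
    · refine le_add_right ?_
      rw [ENNReal.one_le_ofReal]; linarith
  set e : Fin d → ℝ := fun _ => 1
  have he : e ≠ 0 := fun h => one_ne_zero (congrFun h ⟨0, hd⟩)
  have hNe : 0 < N e := (hN e).lt_of_ne' fun h => he ((hN0 e).1 h)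
  have hNn : ∀ n : ℕ, N ((n : ℝ) • e) = n * N e := by
    intro n; rw [hNsmul, Nat.abs_cast]
  have hlin : ∀ η > 0, ∃ s > 0, ρ s ≤ η * s := by
    intro η hη
    have h1 := (Real.continuousAt_log one_ne_zero).tendsto.comp (hgrs e)
    rw [Real.log_one] at h1
    obtain ⟨n, hlt, hn1⟩ :=
      ((h1.eventually_lt_const (mul_pos hη hNe)).and (eventually_gt_atTop 0)).exists
    have hn0 : (0 : ℝ) < n := by exact_mod_cast hn1
    refine ⟨n * N e, by positivity, ?_⟩
    simp only [Function.comp, hω, hNn] at hlt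
    rw [← Real.exp_mul, Real.log_exp, ← div_eq_mul_inv, div_lt_iff₀ hn0] at hlt
    linarith
  have hub : ∀ B, ∃ s, 0 ≤ s ∧ B ≤ ρ s := by
    intro B
    have h1 : Tendsto (fun n : ℕ => C * (1 + (n : ℝ)) ^ δ) atTop atTop :=
      ((tendsto_rpow_atTop hδ).comp
        (tendsto_atTop_add_const_left _ _ tendsto_natCast_atTop_atTop)).const_mul_atTop hC
    obtain ⟨n, hnB⟩ := (h1.eventually_ge_atTop (Real.exp B)).exists
    refine ⟨n * N e, by positivity, ?_⟩
    have h2 := hCδ ((n : ℝ) • e)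
    have : Nonempty (Fin d) := ⟨⟨0, hd⟩⟩
    have hnorm : ‖e‖ = 1 := (pi_norm_const (1 : ℝ)).trans norm_one
    rw [norm_smul, hnorm, mul_one, Real.norm_natCast, hω, hNn] at h2
    exact Real.exp_le_exp.1 (hnB.trans h2)
  have hmono := hρ.monotoneOn_of_nonneg hn
  obtain ⟨s, hs, hsle⟩ := exists_shift_exp_le hρ h0 hn hlin hub hp hε
  refine ⟨fun x => ENNReal.ofReal (Real.exp (p * (ρ (N (zr x) + s) - ρ s))), fun x y => ?_, ?_,
    ⟨ENNReal.ofReal (Real.exp (p * ρ s)), ENNReal.ofReal_ne_top, fun x => ?_⟩, fun x => ?_⟩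
  · rw [← ENNReal.ofReal_mul (Real.exp_nonneg _), ← Real.exp_add, ← mul_add]
    refine ENNReal.ofReal_le_ofReal (Real.exp_le_exp.2 (mul_le_mul_of_nonneg_left ?_ hp.le))
    have hzr : zr (x + y) = zr x + zr y := by ext i; simp [zr]
    refine le_trans ?_ (hρ.shift_subadditive hs (hN _) (hN _))
    gcongr
    refine hmono (Set.mem_Ici.2 (add_nonneg (hN _) hs))
      (Set.mem_Ici.2 (add_nonneg (add_nonneg (hN _) (hN _)) hs)) ?_
    rw [hzr]
    gcongr
    exact hNadd _ _
  · have : zr (0 : Fin d → ℤ) = 0 := by ext i; simp [zr]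
    simp [this, hNzero]
  · rw [hW, ← ENNReal.ofReal_mul (Real.exp_nonneg _), ← Real.exp_add, ← mul_add]
    gcongr
    have := hmono (Set.mem_Ici.2 (hN (zr x))) (Set.mem_Ici.2 (add_nonneg (hN (zr x)) hs))
      (by linarith)
    linarith
  · rw [hW, ← ENNReal.ofReal_mul hε.le, ← ENNReal.ofReal_add (by linarith) (by positivity)]
    exact ENNReal.ofReal_le_ofReal (hsle _ (hN _))

lemma IsAdmissibleWeight.one_le {ω : (Fin d → ℝ) → ℝ} (hadm : IsAdmissibleWeight ω)
    (x : Fin d → ℝ) : 1 ≤ ω x := by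
  obtain ⟨⟨N, ρ, hN, -, -, -, -, -, -, hn, hω⟩, -⟩ := hadm
  rw [hω]
  exact Real.one_le_exp (hn _ (hN x))

lemma IsAdmissibleWeight.neg {ω : (Fin d → ℝ) → ℝ} (hadm : IsAdmissibleWeight ω)
    (x : Fin d → ℝ) : ω (-x) = ω x := by
  obtain ⟨⟨N, ρ, -, -, -, hNsmul, -, -, -, -, hω⟩, -⟩ := hadm
  have : N (-x) = N x := by simpa using hNsmul (-1) x
  rw [hω, hω, this]

/-- Upper exponential growth bound for the weighted row norms of powers. -/
lemma IsAdmissibleWeight.exists_rowNorm_pow_le {ω : (Fin d → ℝ) → ℝ}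
    (hadm : IsAdmissibleWeight ω) (hwg : WeakGrowth ω) {p : ℝ} (hp0 : 0 < p) (hp1 : p ≤ 1)
    {T : lp (fun _ : Fin d → ℤ => ℂ) 2 →L[ℂ] lp (fun _ : Fin d → ℤ => ℂ) 2}
    (hT : rowNorm p (fun x => ENNReal.ofReal (ω (zr x)) ^ p) T ≠ ⊤) {μ : ℝ}
    (hμ : ‖T‖ ^ p < μ) :
    ∃ K : ℝ≥0∞, K ≠ ⊤ ∧ ∀ n,
      rowNorm p (fun x => ENNReal.ofReal (ω (zr x)) ^ p) (T ^ n) ≤ K * ENNReal.ofReal μ ^ n := by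
  set W : (Fin d → ℤ) → ℝ≥0∞ := fun x => ENNReal.ofReal (ω (zr x)) ^ p with hW
  have hμ0 : 0 < μ := (by positivity : 0 ≤ ‖T‖ ^ p).trans_lt hμ
  have hW1 : ∀ x, 1 ≤ W x := fun x =>
    ENNReal.one_le_rpow (ENNReal.one_le_ofReal.2 (hadm.one_le _)) hp0
  have comparison : ∀ {ε : ℝ} (_ : 0 < ε) {w : (Fin d → ℤ) → ℝ≥0∞}
      (_ : ∀ x, w x ≤ ENNReal.ofReal (1 + ε) + ENNReal.ofReal ε * W x)
      (S : lp (fun _ : Fin d → ℤ => ℂ) 2 →L[ℂ] lp (fun _ : Fin d → ℤ => ℂ) 2),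
      rowNorm p w S ≤ ENNReal.ofReal (1 + ε) * rowNorm p (fun _ => 1) S
        + ENNReal.ofReal ε * rowNorm p W S := by
    intro ε _ w hw S
    rw [← rowNorm_smul, ← rowNorm_smul]
    refine (rowNorm_mono (fun x => ?_) S).trans (rowNorm_add_le _ _ S)
    simpa using hw x
  have hfin : ∀ {ε : ℝ} (_ : 0 < ε) {w : (Fin d → ℤ) → ℝ≥0∞}
      (_ : ∀ x, w x ≤ ENNReal.ofReal (1 + ε) + ENNReal.ofReal ε * W x), rowNorm p w T ≠ ⊤ := by
    intro ε hε w hw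
    refine ne_top_of_le_ne_top (ENNReal.add_ne_top.2 ⟨?_, ?_⟩) (comparison hε hw T)
    · exact ENNReal.mul_ne_top ENNReal.ofReal_ne_top (ne_top_of_le_ne_top hT (rowNorm_mono hW1 T))
    · exact ENNReal.mul_ne_top ENNReal.ofReal_ne_top hT
  obtain ⟨c, hc, δ, hδ, hδ1, hcδ⟩ := id hwg
  have hpoly : rowNorm p (fun x => ENNReal.ofReal ((1 + ‖x‖) ^ (δ * p))) T ≠ ⊤ := by
    refine ne_top_of_le_ne_top (ENNReal.mul_ne_top (ENNReal.ofReal_ne_top (r := (c ^ p)⁻¹)) hT) ?_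
    rw [← rowNorm_smul]
    refine rowNorm_mono (fun x => ?_) T
    have hzr : ‖zr x‖ = ‖x‖ := by
      simp only [Pi.norm_def, zr]
      congr! 3
    have h1 := hcδ (zr x)
    rw [hzr] at h1
    rw [hW]
    dsimp only
    rw [ENNReal.ofReal_rpow_of_nonneg (zero_le_one.trans (hadm.one_le _)) hp0.le,
      ← ENNReal.ofReal_mul (by positivity)]
    gcongr
    rw [inv_mul_eq_div, le_div_iff₀ (by positivity), Real.rpow_mul (by positivity),
      ← Real.mul_rpow (by positivity) hc.le, mul_comm]
    gcongr
  obtain ⟨k, hk, hlt⟩ := exists_rowNorm_pow_lt hp0 hp1 (mul_pos hδ hp0)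
    (mul_le_one₀ hδ1 hp0.le hp1) hpoly hμ
  have hkfin : rowNorm p W (T ^ k) ≠ ⊤ := by
    obtain ⟨w, hw, hw0, ⟨C, hC, hCw⟩, hwle⟩ := hadm.exists_equivalent_weight hwg hp0 one_pos
    refine ne_top_of_le_ne_top (ENNReal.mul_ne_top hC (ENNReal.pow_ne_top (n := k)
      (hfin one_pos hwle))) ((rowNorm_mono hCw _).trans ?_)
    rw [rowNorm_smul]
    gcongr
    exact rowNorm_pow_le hp0 hp1 hw hw0 T k
  obtain ⟨ε, hε, hεle⟩ : ∃ ε : ℝ, 0 < ε ∧ ENNReal.ofReal (1 + ε) * rowNorm p (fun _ => 1) (T ^ k)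
      + ENNReal.ofReal ε * rowNorm p W (T ^ k) ≤ ENNReal.ofReal μ ^ k := by
    generalize rowNorm p (fun _ => 1) (T ^ k) = b at hlt
    generalize rowNorm p W (T ^ k) = c at hkfin
    lift b to ℝ≥0 using hlt.ne_top
    lift c to ℝ≥0 using hkfin
    rw [← ENNReal.ofReal_pow hμ0.le, ← ENNReal.ofReal_coe_nnreal] at hlt
    replace hlt := (ENNReal.ofReal_lt_ofReal_iff_of_nonneg b.coe_nonneg).1 hlt
    refine ⟨(μ ^ k - b) / (b + c + 1), div_pos (by linarith) (by positivity), ?_⟩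
    set ε := (μ ^ k - b) / (b + c + 1)
    have hε : 0 < ε := div_pos (by linarith) (by positivity)
    rw [← ENNReal.ofReal_coe_nnreal, ← ENNReal.ofReal_coe_nnreal,
      ← ENNReal.ofReal_mul (by positivity), ← ENNReal.ofReal_mul (by positivity),
      ← ENNReal.ofReal_add (by positivity) (by positivity), ← ENNReal.ofReal_pow hμ0.le]
    refine ENNReal.ofReal_le_ofReal ?_
    have : ε * (b + c + 1) = μ ^ k - b := div_mul_cancel₀ _ (by positivity)
    linarith
  obtain ⟨w, hw, hw0, ⟨C, hC, hCw⟩, hwle⟩ := hadm.exists_equivalent_weight hwg hp0 hε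
  obtain ⟨K, hK, hKle⟩ := _root_.exists_rowNorm_pow_le hp0 hp1 hw hw0 (hfin hε hwle)
    (ENNReal.ofReal_pos.2 hμ0).ne' ENNReal.ofReal_ne_top hk
    ((comparison hε hwle (T ^ k)).trans hεle)
  refine ⟨C * K, ENNReal.mul_ne_top hC hK, fun n => (rowNorm_mono hCw _).trans ?_⟩
  rw [rowNorm_smul, mul_assoc]
  gcongr
  exact hKle n

lemma matrixEntry_eq_of_apply_eq_tsum {A : (Fin d → ℤ) → (Fin d → ℤ) → ℂ}
    {T : lp (fun _ : Fin d → ℤ => ℂ) 2 →L[ℂ] lp (fun _ : Fin d → ℤ => ℂ) 2}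
    (hT : ∀ (f : lp (fun _ : Fin d → ℤ => ℂ) 2) (k : Fin d → ℤ),
      T f k = ∑' l : Fin d → ℤ, A k l * f l) (k l : Fin d → ℤ) :
    matrixEntry T k l = A k l := by
  rw [matrixEntry, hT, tsum_eq_single l]
  · simp
  · intro j hj
    simp [hj]

lemma matpow_eq_matrixEntry {A : (Fin d → ℤ) → (Fin d → ℤ) → ℂ}
    {T : lp (fun _ : Fin d → ℤ => ℂ) 2 →L[ℂ] lp (fun _ : Fin d → ℤ => ℂ) 2}
    (hA : ∀ k l, matrixEntry T k l = A k l) (n : ℕ) (k l : Fin d → ℤ) :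
    matpow A n k l = matrixEntry (T ^ (n + 1)) k l := by
  induction n generalizing k l with
  | zero => simp [matpow, hA]
  | succ n ih =>
    rw [matpow, matmul, pow_succ', matrixEntry_mul]
    exact tsum_congr fun j => by rw [hA, ih]

lemma mnorm_eq_rowNorm {p : ℝ} {ν : (Fin d → ℤ) → ℝ} (hν : ∀ x, ν (-x) = ν x)
    {B : (Fin d → ℤ) → (Fin d → ℤ) → ℂ}
    {S : lp (fun _ : Fin d → ℤ => ℂ) 2 →L[ℂ] lp (fun _ : Fin d → ℤ => ℂ) 2}
    (hB : ∀ k l, B k l = matrixEntry S k l)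
    (hS : ∀ k l, matrixEntry S k l = starRingEnd ℂ (matrixEntry S l k)) :
    mnorm p ν B = rowNorm p (fun x => ENNReal.ofReal (ν x) ^ p) S := by
  have h : ∀ k l, (‖B l k‖₊ : ℝ≥0∞) ^ p * ENNReal.ofReal (ν (l - k)) ^ p
      = (‖B k l‖₊ : ℝ≥0∞) ^ p * ENNReal.ofReal (ν (k - l)) ^ p := by
    intro k l
    rw [hB, hB, hS l k, RCLike.nnnorm_conj, ← neg_sub k l, hν]
  rw [mnorm, max_eq_left (iSup_mono fun k => (tsum_congr (h k)).le)]
  simp only [hB]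
  rfl

end AdmissibleWeight

/-- Let `ω` be an admissible weight on `ℤ^d` satisfying the weak growth condition,
`0 < p ≤ 1`, and `A = A* ∈ A_{pω}`.  Then `lim_n ‖A^n‖_{pω}^{1/n} = ‖A‖_op^p`, where
`‖A‖_op` is the operator norm of `A` acting on `ℓ²(ℤ^d)`. -/
theorem matrix_spectralRadius_eq_opNorm_pow
    {d : ℕ} (p : ℝ) (hp0 : 0 < p) (hp1 : p ≤ 1)
    (ω : (Fin d → ℝ) → ℝ) (hadm : IsAdmissibleWeight ω) (hwg : WeakGrowth ω)
    (A : (Fin d → ℤ) → (Fin d → ℤ) → ℂ)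
    (hsa : ∀ k l, A k l = starRingEnd ℂ (A l k))
    (hA : mnorm p (fun k => ω (zr k)) A < ⊤)
    (T : lp (fun _ : Fin d → ℤ => ℂ) 2 →L[ℂ] lp (fun _ : Fin d → ℤ => ℂ) 2)
    (hT : ∀ (f : lp (fun _ : Fin d → ℤ => ℂ) 2) (k : Fin d → ℤ),
      T f k = ∑' l : Fin d → ℤ, A k l * f l) :
    Tendsto (fun n : ℕ => mnorm p (fun k => ω (zr k)) (matpow A n) ^ (((n : ℝ) + 1)⁻¹))
      atTop (nhds (ENNReal.ofReal (‖T‖ ^ p))) := by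
  have hent := matrixEntry_eq_of_apply_eq_tsum hT
  have hTsa : ∀ k l, matrixEntry T k l = starRingEnd ℂ (matrixEntry T l k) := by
    intro k l; rw [hent, hent]; exact hsa k l
  have hνneg : ∀ x : Fin d → ℤ, ω (zr (-x)) = ω (zr x) := by
    intro x
    rw [← hadm.neg (zr x)]
    congr 1
    ext i
    simp [zr]
  have hnorm : ∀ n, mnorm p (fun k => ω (zr k)) (matpow A n)
      = rowNorm p (fun x => ENNReal.ofReal (ω (zr x)) ^ p) (T ^ (n + 1)) := fun n =>
    mnorm_eq_rowNorm hνneg (matpow_eq_matrixEntry hent n) (matrixEntry_pow_hermitian hTsa (n + 1))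
  have hTfin : rowNorm p (fun x => ENNReal.ofReal (ω (zr x)) ^ p) T ≠ ⊤ := by
    rw [← mnorm_eq_rowNorm hνneg (fun k l => (hent k l).symm) hTsa]
    exact hA.ne
  have hexp : ∀ (n : ℕ) (x : ℝ≥0∞), (x ^ (n + 1)) ^ (((n : ℝ) + 1)⁻¹) = x := by
    intro n x
    rw [← ENNReal.rpow_natCast, ← ENNReal.rpow_mul]
    push_cast
    rw [mul_inv_cancel₀ (by positivity), ENNReal.rpow_one]
  have hlower : ∀ n : ℕ, ENNReal.ofReal (‖T‖ ^ p)
      ≤ mnorm p (fun k => ω (zr k)) (matpow A n) ^ (((n : ℝ) + 1)⁻¹) := by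
    intro n
    have := lp.nontrivial_of_nonempty (ι := Fin d → ℤ)
    rw [← hexp n (ENNReal.ofReal (‖T‖ ^ p)), hnorm]
    gcongr
    rw [← ENNReal.ofReal_pow (by positivity), ← Real.rpow_natCast, ← Real.rpow_mul (norm_nonneg _),
      mul_comm, Real.rpow_mul (norm_nonneg _), Real.rpow_natCast,
      ← (isSelfAdjoint_of_matrixEntry_hermitian hTsa).norm_pow_eq]
    refine (ofReal_opNorm_rpow_le_rowNorm hp0 hp1 (matrixEntry_pow_hermitian hTsa _)).trans ?_
    exact rowNorm_mono (fun x => ENNReal.one_le_rpow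
      (ENNReal.one_le_ofReal.2 (hadm.one_le _)) hp0) _
  refine tendsto_order.2 ⟨fun a ha => Eventually.of_forall fun n => ha.trans_le (hlower n),
    fun a ha => ?_⟩
  obtain ⟨μ, -, hμ1, hμ2⟩ := ENNReal.lt_iff_exists_real_btwn.1 ha
  obtain ⟨K, hK, hKle⟩ := hadm.exists_rowNorm_pow_le hwg hp0 hp1 hTfin
    ((ENNReal.ofReal_lt_ofReal_iff_of_nonneg (by positivity)).1 hμ1)
  have hK1 : max K 1 ≠ ⊤ := by simp [hK]
  have hlim : Tendsto (fun n : ℕ => max K 1 ^ (((n : ℝ) + 1)⁻¹) * ENNReal.ofReal μ) atTop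
      (nhds (1 * ENNReal.ofReal μ)) := by
    refine ENNReal.Tendsto.mul_const ?_ (Or.inl one_ne_zero)
    have h0 : Tendsto (fun n : ℕ => ((n : ℝ) + 1)⁻¹) atTop (nhds 0) := by
      simpa using tendsto_one_div_add_atTop_nhds_zero_nat (𝕜 := ℝ)
    lift max K 1 to ℝ≥0 using hK1 with L hL
    have hL0 : L ≠ 0 := by
      rintro rfl
      have h1 : (1 : ℝ≥0∞) ≤ max K 1 := le_max_right _ _
      simp [← hL] at h1
    have h1 := (NNReal.continuousAt_rpow (x := L) (y := 0) (Or.inl hL0)).tendsto.comp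
      ((tendsto_const_nhds (x := L)).prodMk_nhds h0)
    have h2 := ENNReal.tendsto_coe.2 h1
    simpa [Function.comp_def, ENNReal.coe_rpow_of_ne_zero hL0] using h2
  rw [one_mul] at hlim
  filter_upwards [hlim.eventually_lt_const hμ2] with n hn
  refine lt_of_le_of_lt ?_ hn
  rw [hnorm, ← hexp n (ENNReal.ofReal μ), ← ENNReal.mul_rpow_of_nonneg _ _ (by positivity)]
  gcongr
  exact (hKle (n + 1)).trans (by gcongr; exact le_max_left _ _)
end

section
/- Let ω be an admissible weight on ℤ^d satisfying the weak growth condition and let 0<p≤1. Suppose A is an invertible bounded operator on ℓ²(ℤ^d) whose matrix (a_{kl})_{k,l∈ℤ^d} (defined by a_{kl} = ⟨A δ_l, δ_k⟩, where δ_k are the standard basis vectors) satisfies max{ sup_k Σ_l |a_{kl}|^p ω(k−l)^p , sup_l Σ_k |a_{kl}|^p ω(k−l)^p } < ∞. Then the matrix (b_{kl})_{k,l∈ℤ^d} of the inverse operator A^{-1} satisfies the same condition: max{ sup_k Σ_l |b_{kl}|^p ω(k−l)^p , sup_l Σ_k |b_{kl}|^p ω(k−l)^p } < ∞. -/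
open scoped ENNReal NNReal
open Filter

section Schur
variable {ι : Type*}

/-- The Schur norm of a nonnegative kernel: the larger of its suprema of row and column sums. -/
noncomputable def schur (f : ι → ι → ℝ≥0∞) : ℝ≥0∞ :=
  max (⨆ k, ∑' l, f k l) (⨆ l, ∑' k, f k l)

theorem row_le_schur (f : ι → ι → ℝ≥0∞) (k : ι) : ∑' l, f k l ≤ schur f :=
  le_max_of_le_left (le_iSup (fun k => ∑' l, f k l) k)

theorem col_le_schur (f : ι → ι → ℝ≥0∞) (l : ι) : ∑' k, f k l ≤ schur f :=
  le_max_of_le_right (le_iSup (fun l => ∑' k, f k l) l)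

theorem schur_le {f : ι → ι → ℝ≥0∞} {c : ℝ≥0∞} (hr : ∀ k, ∑' l, f k l ≤ c)
    (hc : ∀ l, ∑' k, f k l ≤ c) : schur f ≤ c :=
  max_le (iSup_le hr) (iSup_le hc)

theorem schur_mono {f g : ι → ι → ℝ≥0∞} (h : ∀ k l, f k l ≤ g k l) : schur f ≤ schur g :=
  schur_le (fun k => (ENNReal.tsum_le_tsum (h k)).trans (row_le_schur g k))
    (fun l => (ENNReal.tsum_le_tsum (fun k => h k l)).trans (col_le_schur g l))

theorem schur_swap (f : ι → ι → ℝ≥0∞) : schur (fun k l => f l k) = schur f :=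
  max_comm _ _

theorem schur_add_le (f g : ι → ι → ℝ≥0∞) :
    schur (fun k l => f k l + g k l) ≤ schur f + schur g :=
  schur_le
    (fun k => ENNReal.tsum_add.le.trans (add_le_add (row_le_schur f k) (row_le_schur g k)))
    (fun l => ENNReal.tsum_add.le.trans (add_le_add (col_le_schur f l) (col_le_schur g l)))

theorem schur_const_mul_le (c : ℝ≥0∞) (f : ι → ι → ℝ≥0∞) :
    schur (fun k l => c * f k l) ≤ c * schur f :=
  schur_le (fun k => ENNReal.tsum_mul_left.le.trans (by gcongr; exact row_le_schur f k))
    (fun l => ENNReal.tsum_mul_left.le.trans (by gcongr; exact col_le_schur f l))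

theorem schur_tsum_le {α : Type*} (f : α → ι → ι → ℝ≥0∞) :
    schur (fun k l => ∑' n, f n k l) ≤ ∑' n, schur (f n) :=
  schur_le
    (fun k => ENNReal.tsum_comm.le.trans (ENNReal.tsum_le_tsum fun n => row_le_schur (f n) k))
    (fun l => ENNReal.tsum_comm.le.trans (ENNReal.tsum_le_tsum fun n => col_le_schur (f n) l))

theorem schur_comp_le (f g : ι → ι → ℝ≥0∞) :
    schur (fun k l => ∑' j, f k j * g j l) ≤ schur f * schur g := by
  refine schur_le (fun k => ?_) (fun l => ?_)
  · calc ∑' l, ∑' j, f k j * g j l = ∑' j, f k j * ∑' l, g j l := by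
          rw [ENNReal.tsum_comm]; simp_rw [ENNReal.tsum_mul_left]
      _ ≤ ∑' j, f k j * schur g := by gcongr with j; exact row_le_schur g j
      _ ≤ schur f * schur g := by
          rw [ENNReal.tsum_mul_right]; gcongr; exact row_le_schur f k
  · calc ∑' k, ∑' j, f k j * g j l = ∑' j, (∑' k, f k j) * g j l := by
          rw [ENNReal.tsum_comm]; simp_rw [ENNReal.tsum_mul_right]
      _ ≤ ∑' j, schur f * g j l := by gcongr with j; exact col_le_schur f j
      _ ≤ schur f * schur g := by
          rw [ENNReal.tsum_mul_left]; gcongr; exact col_le_schur g l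

theorem ENNReal.rpow_finsetSum_le {p : ℝ} (hp0 : 0 < p) (hp1 : p ≤ 1) {α : Type*}
    (s : Finset α) (f : α → ℝ≥0∞) : (∑ i ∈ s, f i) ^ p ≤ ∑ i ∈ s, f i ^ p := by
  classical
  induction s using Finset.induction_on with
  | empty => simp [hp0]
  | insert a s ha ih =>
    rw [Finset.sum_insert ha, Finset.sum_insert ha]
    exact (ENNReal.rpow_add_le_add_rpow _ _ hp0.le hp1).trans (by gcongr)

theorem ENNReal.rpow_tsum_le {p : ℝ} (hp0 : 0 < p) (hp1 : p ≤ 1) {α : Type*}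
    (f : α → ℝ≥0∞) : (∑' i, f i) ^ p ≤ ∑' i, f i ^ p := by
  have h := ((ENNReal.continuous_rpow_const (y := p)).tendsto _).comp
    (ENNReal.summable (f := f)).hasSum
  exact le_of_tendsto' h fun s =>
    (ENNReal.rpow_finsetSum_le hp0 hp1 s f).trans (ENNReal.sum_le_tsum s)

theorem HasSum.enorm_rpow_le {p : ℝ} (hp0 : 0 < p) (hp1 : p ≤ 1) {α : Type*}
    {f : α → ℂ} {s : ℂ} (h : HasSum f s) : ‖s‖ₑ ^ p ≤ ∑' i, ‖f i‖ₑ ^ p := by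
  have h' : Tendsto (fun t : Finset α => ‖∑ i ∈ t, f i‖ₑ) atTop (nhds ‖s‖ₑ) :=
    (continuous_enorm.tendsto s).comp h
  have : ‖s‖ₑ ≤ ∑' i, ‖f i‖ₑ :=
    le_of_tendsto' h' fun t => (enorm_sum_le _ _).trans (ENNReal.sum_le_tsum t)
  exact (ENNReal.rpow_le_rpow this hp0.le).trans (ENNReal.rpow_tsum_le hp0 hp1 _)

end Schur

section Real

theorem concaveOn_add_le {ρ : ℝ → ℝ} (hρ : ConcaveOn ℝ (Set.Ici 0) ρ) {a b h : ℝ} (ha : 0 ≤ a)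
    (hab : a ≤ b) (hh : 0 ≤ h) : ρ a + ρ (b + h) ≤ ρ (a + h) + ρ b := by
  rcases (add_nonneg (sub_nonneg.2 hab) hh).eq_or_lt with h0 | h0
  · have h1 : h = 0 := by linarith
    have h2 : a = b := by linarith
    subst h1 h2; simp
  · set c := b - a + h with hc
    have hsum : (b - a) / c + h / c = 1 := by rw [← add_div, div_self h0.ne']
    have hsum' : h / c + (b - a) / c = 1 := by rw [add_comm, hsum]
    have ha' : a ∈ Set.Ici (0 : ℝ) := ha
    have hb' : b + h ∈ Set.Ici (0 : ℝ) := by simp; linarith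
    have h1 := hρ.2 ha' hb' (div_nonneg (sub_nonneg.2 hab) h0.le) (div_nonneg hh h0.le) hsum
    have h2 := hρ.2 ha' hb' (div_nonneg hh h0.le) (div_nonneg (sub_nonneg.2 hab) h0.le) hsum'
    simp only [smul_eq_mul] at h1 h2
    have e1 : (b - a) / c * a + h / c * (b + h) = a + h := by
      field_simp; rw [hc]; ring
    have e2 : h / c * a + (b - a) / c * (b + h) = b := by
      field_simp; rw [hc]; ring
    rw [e1] at h1
    rw [e2] at h2
    have e3 : (b - a) / c * ρ a + h / c * ρ (b + h) + (h / c * ρ a + (b - a) / c * ρ (b + h))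
        = ρ a + ρ (b + h) := by
      linear_combination (ρ a + ρ (b + h)) * hsum
    linarith

theorem concaveOn_monotoneOn_of_nonneg {ρ : ℝ → ℝ} (hρ : ConcaveOn ℝ (Set.Ici 0) ρ)
    (hn : ∀ t, 0 ≤ t → 0 ≤ ρ t) : MonotoneOn ρ (Set.Ici 0) := by
  intro a ha b hb hab
  by_contra! hlt
  have hra : 0 < ρ a := (hn b hb).trans_lt hlt
  have hab' : a < b := hab.lt_of_ne (by rintro rfl; exact lt_irrefl _ hlt)
  set s := (ρ a - ρ b) / (2 * ρ a) with hs
  have hs0 : 0 < s := by apply div_pos <;> linarith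
  have hs1 : s ≤ 1 := by
    rw [hs, div_le_one (by linarith)]; linarith [hn b hb]
  have hc : 0 ≤ a + (b - a) / s :=
    add_nonneg ha (div_nonneg (by linarith) hs0.le)
  have h1 := hρ.2 ha (show a + (b - a) / s ∈ Set.Ici (0 : ℝ) from hc)
    (show 0 ≤ 1 - s by linarith) hs0.le (by ring)
  simp only [smul_eq_mul] at h1
  have e : (1 - s) * a + s * (a + (b - a) / s) = b := by field_simp; ring
  rw [e] at h1
  have e2 : s * ρ a = (ρ a - ρ b) / 2 := by rw [hs]; field_simp
  nlinarith [mul_nonneg hs0.le (hn _ hc)]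

theorem exists_lt_one_of_bootstrap {X Y : ℕ → ℝ} {C γ : ℝ} (hC : 0 < C) (hγ : 0 < γ)
    (hX : ∀ j, X (j + 1) ≤ 2 * X j * Y j)
    (hY : ∀ j, Y j ≤ C * Real.exp (-(γ * 2 ^ j)) * (1 + X j)) : ∃ j, Y j < 1 := by
  by_contra! hY1
  have htend : Tendsto (fun j : ℕ => γ * (2 : ℝ) ^ j) atTop atTop :=
    (tendsto_pow_atTop_atTop_of_one_lt one_lt_two).const_mul_atTop hγ
  have hexp : Tendsto (fun j : ℕ => C * Real.exp (-(γ * 2 ^ j))) atTop (nhds (C * 0)) :=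
    (Real.tendsto_exp_neg_atTop_nhds_zero.comp htend).const_mul C
  rw [mul_zero] at hexp
  have hev := (hexp.eventually (gt_mem_nhds (show (0 : ℝ) < 1 / 2 by norm_num))).and
    (htend.eventually (eventually_ge_atTop (2 * Real.log (4 * C))))
  obtain ⟨j₀, hj₀⟩ := eventually_atTop.1 hev
  have hX1 : ∀ j, j₀ ≤ j → 1 ≤ X j := by
    intro j hj
    by_contra! hlt
    have := hY j
    have h1 := hY1 j
    have h2 := (hj₀ j hj).1
    have h3 : 0 < C * Real.exp (-(γ * 2 ^ j)) := by positivity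
    nlinarith
  have hstep : ∀ j, j₀ ≤ j → Real.log (X (j + 1)) / 2 ^ (j + 1)
      ≤ Real.log (X j) / 2 ^ j - γ / 4 := by
    intro j hj
    have hxj := hX1 j hj
    have hE : 0 < C * Real.exp (-(γ * 2 ^ j)) := by positivity
    have h1 : X (j + 1) ≤ 4 * C * Real.exp (-(γ * 2 ^ j)) * X j ^ 2 := by
      have h2 : Y j ≤ C * Real.exp (-(γ * 2 ^ j)) * (2 * X j) :=
        (hY j).trans (by gcongr; linarith)
      calc X (j + 1) ≤ 2 * X j * Y j := hX j
        _ ≤ 2 * X j * (C * Real.exp (-(γ * 2 ^ j)) * (2 * X j)) := by gcongr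
        _ = _ := by ring
    have h2 := Real.log_le_log (by linarith [hX1 (j + 1) (by omega)]) h1
    rw [Real.log_mul (by positivity) (by positivity), Real.log_mul (by positivity) (by positivity),
      Real.log_exp, Real.log_pow] at h2
    have h3 := (hj₀ j hj).2
    rw [div_le_iff₀ (by positivity), sub_mul]
    have e : Real.log (X j) / 2 ^ j * 2 ^ (j + 1) = 2 * Real.log (X j) := by
      rw [pow_succ]; field_simp
    rw [e, pow_succ]
    push_cast at h2
    linarith
  have hind : ∀ i : ℕ, Real.log (X (j₀ + i)) / 2 ^ (j₀ + i)
      ≤ Real.log (X j₀) / 2 ^ j₀ - i * (γ / 4) := by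
    intro i
    induction i with
    | zero => simp
    | succ i ih =>
      have := hstep (j₀ + i) (by omega)
      push_cast
      rw [← add_assoc]
      linarith
  obtain ⟨i, hi⟩ := exists_nat_gt (Real.log (X j₀) / 2 ^ j₀ / (γ / 4))
  rw [div_lt_iff₀ (by positivity)] at hi
  have h1 : 0 ≤ Real.log (X (j₀ + i)) / 2 ^ (j₀ + i) :=
    div_nonneg (Real.log_nonneg (hX1 _ (by omega))) (by positivity)
  linarith [hind i]

end Real

section Operators

variable {G : Type*} [DecidableEq G]

/-- The matrix entry `(k, l)` as a continuous linear functional on bounded operators. -/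
noncomputable def entryCLM (k l : G) :
    (lp (fun _ : G => ℂ) 2 →L[ℂ] lp (fun _ : G => ℂ) 2) →L[ℂ] ℂ :=
  (lp.evalCLM ℂ (fun _ : G => ℂ) 2 k).comp
    (ContinuousLinearMap.apply ℂ (lp (fun _ : G => ℂ) 2) (lp.single 2 l (1 : ℂ)))

theorem hasSum_entry_mul (S T : lp (fun _ : G => ℂ) 2 →L[ℂ] lp (fun _ : G => ℂ) 2) (k l : G) :
    HasSum (fun j => S (lp.single 2 j 1) k * T (lp.single 2 l 1) j)
      ((S * T) (lp.single 2 l 1) k) := by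
  have h := lp.hasSum_single (p := 2) (by norm_num) (T (lp.single 2 l (1 : ℂ)))
  have h2 := (((lp.evalCLM ℂ (fun _ : G => ℂ) 2 k).comp S).hasSum h)
  have h3 : ∀ j, S (lp.single 2 j 1) k * T (lp.single 2 l 1) j
      = (lp.evalCLM ℂ (fun _ : G => ℂ) 2 k).comp S (lp.single 2 j (T (lp.single 2 l 1) j)) := by
    intro j
    have : (lp.single 2 j (T (lp.single 2 l 1) j) : lp (fun _ : G => ℂ) 2)
        = T (lp.single 2 l 1) j • lp.single 2 j (1 : ℂ) := by
      rw [← lp.single_smul, smul_eq_mul, mul_one]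
    rw [this, map_smul, smul_eq_mul, mul_comm]
    rfl
  simp_rw [h3]
  exact h2

theorem norm_entry_le (T : lp (fun _ : G => ℂ) 2 →L[ℂ] lp (fun _ : G => ℂ) 2) (k l : G) :
    ‖T (lp.single 2 l 1) k‖ ≤ ‖T‖ := by
  refine (lp.norm_apply_le_norm (by norm_num) _ k).trans ((T.le_opNorm _).trans ?_)
  rw [lp.norm_single (by norm_num)]
  simp

theorem adjoint_entry (T : lp (fun _ : G => ℂ) 2 →L[ℂ] lp (fun _ : G => ℂ) 2) (k l : G) :
    (ContinuousLinearMap.adjoint T) (lp.single 2 l 1) k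
      = (starRingEnd ℂ) (T (lp.single 2 k 1) l) := by
  have h1 := lp.inner_single_left (𝕜 := ℂ) (G := fun _ : G => ℂ) k (1 : ℂ)
    ((ContinuousLinearMap.adjoint T) (lp.single 2 l 1))
  rw [ContinuousLinearMap.adjoint_inner_right, lp.inner_single_right] at h1
  simpa using h1.symm

theorem enorm_entry_mul_rpow_le {p : ℝ} (hp0 : 0 < p) (hp1 : p ≤ 1)
    (S T : lp (fun _ : G => ℂ) 2 →L[ℂ] lp (fun _ : G => ℂ) 2) (k l : G) :
    ‖(S * T) (lp.single 2 l 1) k‖ₑ ^ p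
      ≤ ∑' j, ‖S (lp.single 2 j 1) k‖ₑ ^ p * ‖T (lp.single 2 l 1) j‖ₑ ^ p := by
  refine ((hasSum_entry_mul S T k l).enorm_rpow_le hp0 hp1).trans_eq ?_
  congr with j
  rw [enorm_mul, ENNReal.mul_rpow_of_nonneg _ _ hp0.le]

variable [AddCommGroup G]

/-- The weighted Schur `p`-norm of the matrix of a bounded operator on `ℓ²(G)`, where the weight
`w` stands for the `p`-th power of the original weight. -/
noncomputable def opSchur (p : ℝ) (w : G → ℝ≥0∞)
    (T : lp (fun _ : G => ℂ) 2 →L[ℂ] lp (fun _ : G => ℂ) 2) : ℝ≥0∞ :=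
  schur fun k l => ‖T (lp.single 2 l 1) k‖ₑ ^ p * w (k - l)

variable {p : ℝ} {w : G → ℝ≥0∞}

theorem opSchur_add_le (hp0 : 0 < p) (hp1 : p ≤ 1)
    (S T : lp (fun _ : G => ℂ) 2 →L[ℂ] lp (fun _ : G => ℂ) 2) :
    opSchur p w (S + T) ≤ opSchur p w S + opSchur p w T := by
  refine (schur_mono fun k l => ?_).trans (schur_add_le _ _)
  rw [← add_mul]
  gcongr
  exact (ENNReal.rpow_le_rpow (enorm_add_le _ _) hp0.le).trans
    (ENNReal.rpow_add_le_add_rpow _ _ hp0.le hp1)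

theorem opSchur_smul_le (hp0 : 0 < p) (c : ℂ)
    (T : lp (fun _ : G => ℂ) 2 →L[ℂ] lp (fun _ : G => ℂ) 2) :
    opSchur p w (c • T) ≤ ‖c‖ₑ ^ p * opSchur p w T := by
  refine (schur_mono fun k l => ?_).trans (schur_const_mul_le _ _)
  rw [← mul_assoc, ← ENNReal.mul_rpow_of_nonneg _ _ hp0.le]
  gcongr
  exact (enorm_smul _ _).le

theorem opSchur_one_le (hp0 : 0 < p) :
    opSchur p w (1 : lp (fun _ : G => ℂ) 2 →L[ℂ] lp (fun _ : G => ℂ) 2) ≤ w 0 := by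
  have h : ∀ k l : G, k ≠ l → ‖((1 : lp (fun _ : G => ℂ) 2 →L[ℂ] lp (fun _ : G => ℂ) 2)
      (lp.single 2 l 1)) k‖ₑ ^ p * w (k - l) = 0 := fun k l hkl => by
    rw [one_apply_eq_self, lp.single_apply_ne _ _ _ hkl]
    simp [hp0]
  refine schur_le (fun k => ?_) (fun l => ?_)
  · rw [tsum_eq_single k fun l hl => h k l hl.symm, one_apply_eq_self,
      lp.single_apply_self]
    simp
  · rw [tsum_eq_single l fun k hk => h k l hk, one_apply_eq_self,
      lp.single_apply_self]
    simp

theorem opSchur_mul_le (hp0 : 0 < p) (hp1 : p ≤ 1) (hw : ∀ x y, w (x + y) ≤ w x * w y)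
    (S T : lp (fun _ : G => ℂ) 2 →L[ℂ] lp (fun _ : G => ℂ) 2) :
    opSchur p w (S * T) ≤ opSchur p w S * opSchur p w T := by
  refine (schur_mono fun k l => ?_).trans (schur_comp_le _ _)
  refine (mul_le_mul_left (enorm_entry_mul_rpow_le hp0 hp1 S T k l) _).trans ?_
  rw [← ENNReal.tsum_mul_right]
  refine ENNReal.tsum_le_tsum fun j => ?_
  have := hw (k - j) (j - l)
  rw [sub_add_sub_cancel] at this
  refine (mul_le_mul_right this _).trans_eq (by ring)

theorem opSchur_mul_le_of_subadditive (hp0 : 0 < p) (hp1 : p ≤ 1)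
    (hw : ∀ x y, w (x + y) ≤ w x + w y)
    (S T : lp (fun _ : G => ℂ) 2 →L[ℂ] lp (fun _ : G => ℂ) 2) :
    opSchur p w (S * T)
      ≤ opSchur p w S * opSchur p 1 T + opSchur p 1 S * opSchur p w T := by
  refine (schur_mono fun k l => ?_).trans ((schur_add_le _ _).trans
    (add_le_add (schur_comp_le _ _) (schur_comp_le _ _)))
  refine (mul_le_mul_left (enorm_entry_mul_rpow_le hp0 hp1 S T k l) _).trans ?_
  rw [← ENNReal.tsum_mul_right, ← ENNReal.tsum_add]
  refine ENNReal.tsum_le_tsum fun j => ?_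
  have := hw (k - j) (j - l)
  rw [sub_add_sub_cancel] at this
  refine (mul_le_mul_right this _).trans_eq ?_
  simp only [Pi.one_apply]
  ring

theorem opSchur_le_const_mul {w' : G → ℝ≥0∞} {c : ℝ≥0∞} (h : ∀ x, w x ≤ c * w' x)
    (T : lp (fun _ : G => ℂ) 2 →L[ℂ] lp (fun _ : G => ℂ) 2) :
    opSchur p w T ≤ c * opSchur p w' T :=
  (schur_mono fun _ _ => (mul_le_mul_right (h _) _).trans_eq (mul_left_comm _ _ _)).trans
    (schur_const_mul_le _ _)

theorem opSchur_adjoint (hw : ∀ x, w (-x) = w x)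
    (T : lp (fun _ : G => ℂ) 2 →L[ℂ] lp (fun _ : G => ℂ) 2) :
    opSchur p w (ContinuousLinearMap.adjoint T) = opSchur p w T := by
  rw [opSchur, opSchur, ← schur_swap]
  congr with k l
  rw [adjoint_entry, RCLike.enorm_conj, ← hw, neg_sub]

theorem opSchur_tsum_le (hp0 : 0 < p) (hp1 : p ≤ 1)
    {F : ℕ → lp (fun _ : G => ℂ) 2 →L[ℂ] lp (fun _ : G => ℂ) 2} (hF : Summable F) :
    opSchur p w (∑' n, F n) ≤ ∑' n, opSchur p w (F n) := by
  refine (schur_mono fun k l => ?_).trans (schur_tsum_le _)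
  rw [ENNReal.tsum_mul_right]
  gcongr
  exact ((entryCLM k l).hasSum hF.hasSum).enorm_rpow_le hp0 hp1

theorem opSchur_pow_le (hp0 : 0 < p) (hp1 : p ≤ 1) (hw : ∀ x y, w (x + y) ≤ w x * w y)
    (hw0 : w 0 ≤ 1) (T : lp (fun _ : G => ℂ) 2 →L[ℂ] lp (fun _ : G => ℂ) 2) (n : ℕ) :
    opSchur p w (T ^ n) ≤ opSchur p w T ^ n := by
  induction n with
  | zero => simpa using (opSchur_one_le hp0).trans hw0
  | succ n ih =>
    rw [pow_succ, pow_succ]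
    exact (opSchur_mul_le hp0 hp1 hw _ _).trans (by gcongr)

theorem opSchur_sum_lt_top (hp0 : 0 < p) (hp1 : p ≤ 1) {α : Type*} (s : Finset α)
    {F : α → lp (fun _ : G => ℂ) 2 →L[ℂ] lp (fun _ : G => ℂ) 2}
    (hF : ∀ i ∈ s, opSchur p w (F i) < ⊤) : opSchur p w (∑ i ∈ s, F i) < ⊤ := by
  classical
  induction s using Finset.induction_on with
  | empty =>
    have := opSchur_smul_le (w := w) hp0 0 (0 : lp (fun _ : G => ℂ) 2 →L[ℂ] lp (fun _ : G => ℂ) 2)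
    simp [hp0] at this
    simp [this]
  | insert a s ha ih =>
    rw [Finset.sum_insert ha]
    exact (opSchur_add_le hp0 hp1 _ _).trans_lt (ENNReal.add_lt_top.2
      ⟨hF a (Finset.mem_insert_self a s), ih fun i hi => hF i (Finset.mem_insert_of_mem hi)⟩)

/-- Neumann series: if some power of `R` has weighted Schur norm below one, then the inverse of
`1 - R` has finite weighted Schur norm. -/
theorem opSchur_leftInverse_lt_top (hp0 : 0 < p) (hp1 : p ≤ 1)
    (hw : ∀ x y, w (x + y) ≤ w x * w y) (hw0 : w 0 ≤ 1)
    {R S : lp (fun _ : G => ℂ) 2 →L[ℂ] lp (fun _ : G => ℂ) 2} (hR : ‖R‖ < 1)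
    (hRw : opSchur p w R < ⊤) {k : ℕ} (hk : k ≠ 0) (hRk : opSchur p w (R ^ k) < 1)
    (hS : (1 - R) * S = 1) : opSchur p w S < ⊤ := by
  have hRk1 : ‖R ^ k‖ < 1 :=
    (norm_pow_le' R (Nat.pos_of_ne_zero hk)).trans_lt (pow_lt_one₀ (norm_nonneg _) hR hk)
  have hSeq : S = (∑' n, (R ^ k) ^ n) * ∑ i ∈ Finset.range k, R ^ i := by
    have h1 : (∑ i ∈ Finset.range k, R ^ i) * (1 - R) = 1 - R ^ k := geom_sum_mul_neg R k
    calc S = ((∑' n, (R ^ k) ^ n) * (1 - R ^ k)) * S := by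
          rw [geom_series_mul_neg _ hRk1, one_mul]
      _ = ((∑' n, (R ^ k) ^ n) * ∑ i ∈ Finset.range k, R ^ i) * ((1 - R) * S) := by
          rw [← h1]; simp only [mul_assoc]
      _ = _ := by rw [hS, mul_one]
  rw [hSeq]
  refine (opSchur_mul_le hp0 hp1 hw _ _).trans_lt (ENNReal.mul_lt_top ?_ ?_)
  · refine (opSchur_tsum_le hp0 hp1 (summable_geometric_of_norm_lt_one hRk1)).trans_lt ?_
    refine (ENNReal.tsum_le_tsum fun n => opSchur_pow_le hp0 hp1 hw hw0 (R ^ k) n).trans_lt ?_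
    rw [ENNReal.tsum_geometric]
    exact ENNReal.inv_lt_top.2 (tsub_pos_of_lt hRk)
  · exact opSchur_sum_lt_top hp0 hp1 _ fun i _ =>
      (opSchur_pow_le hp0 hp1 hw hw0 R i).trans_lt (ENNReal.pow_lt_top hRw)

end Operators

section Contraction

/-- If `A` is bounded below, then `1 - t A⋆A` is a strict contraction for some `t > 0`. -/
theorem exists_norm_one_sub_smul_adjoint_mul_lt_one {H : Type*} [NormedAddCommGroup H]
    [InnerProductSpace ℂ H] [CompleteSpace H] {A B : H →L[ℂ] H} (hBA : B * A = 1) :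
    ∃ t : ℝ, 0 < t ∧ ‖1 - (t : ℂ) • (ContinuousLinearMap.adjoint A * A)‖ < 1 := by
  set a := ‖A‖ ^ 2 + 1 with ha
  set b := ‖B‖ ^ 2 + 1 with hb
  have ha0 : 0 < a := by positivity
  have hb0 : 0 < b := by positivity
  refine ⟨1 / a, by positivity, ?_⟩
  set c := max 0 (1 - 1 / a / b) with hc
  have hc0 : 0 ≤ c := le_max_left _ _
  have hc1 : c < 1 := max_lt one_pos (by have : 0 < 1 / a / b := by positivity
                                         linarith)
  refine (ContinuousLinearMap.opNorm_le_bound _ (Real.sqrt_nonneg c) fun x => ?_).trans_lt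
    ((Real.sqrt_lt' one_pos).2 (by simpa using hc1))
  have hx : x = B (A x) := by
    have := congrArg (fun T : H →L[ℂ] H => T x) hBA
    simpa using this.symm
  have hxb : ‖x‖ ^ 2 ≤ b * ‖A x‖ ^ 2 := by
    have h1 : ‖x‖ ≤ ‖B‖ * ‖A x‖ := by
      conv_lhs => rw [hx]
      exact B.le_opNorm _
    have h2 : ‖x‖ ^ 2 ≤ (‖B‖ * ‖A x‖) ^ 2 := by gcongr
    nlinarith [sq_nonneg ‖A x‖]
  set y := ContinuousLinearMap.adjoint A (A x) with hy
  have hyn : ‖y‖ ^ 2 ≤ a * ‖A x‖ ^ 2 := by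
    have h1 : ‖y‖ ≤ ‖A‖ * ‖A x‖ := by
      have := (ContinuousLinearMap.adjoint A).le_opNorm (A x)
      rwa [LinearIsometryEquiv.norm_map] at this
    have h2 : ‖y‖ ^ 2 ≤ (‖A‖ * ‖A x‖) ^ 2 := by gcongr
    nlinarith [sq_nonneg ‖A x‖]
  have hinner : RCLike.re (inner ℂ x y) = ‖A x‖ ^ 2 := by
    rw [hy, ContinuousLinearMap.adjoint_inner_right, inner_self_eq_norm_sq]
  have hval : (1 - ((1 / a : ℝ) : ℂ) • (ContinuousLinearMap.adjoint A * A)) x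
      = x - ((1 / a : ℝ) : ℂ) • y := rfl
  rw [hval, ← abs_of_nonneg (norm_nonneg (x - _)), ← abs_of_nonneg (norm_nonneg x),
    ← Real.sqrt_sq_eq_abs, ← Real.sqrt_sq_eq_abs, ← Real.sqrt_mul hc0]
  apply Real.sqrt_le_sqrt
  have hre : RCLike.re (((1 / a : ℝ) : ℂ) * inner ℂ x y) = 1 / a * ‖A x‖ ^ 2 :=
    (Complex.re_ofReal_mul _ _).trans (congrArg (1 / a * ·) hinner)
  have hexp : ‖x - ((1 / a : ℝ) : ℂ) • y‖ ^ 2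
      = ‖x‖ ^ 2 - 2 * (1 / a * ‖A x‖ ^ 2) + (1 / a) ^ 2 * ‖y‖ ^ 2 := by
    rw [@norm_sub_sq ℂ, inner_smul_right, norm_smul, mul_pow, hre]
    congr 2
    rw [Complex.norm_real, Real.norm_of_nonneg (by positivity)]
  rw [hexp]
  have h1 : (1 / a) ^ 2 * ‖y‖ ^ 2 ≤ 1 / a * ‖A x‖ ^ 2 := by
    calc (1 / a) ^ 2 * ‖y‖ ^ 2 ≤ (1 / a) ^ 2 * (a * ‖A x‖ ^ 2) := by gcongr
      _ = 1 / a * ‖A x‖ ^ 2 := by field_simp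
  have h2 : 1 / a / b * ‖x‖ ^ 2 ≤ 1 / a * ‖A x‖ ^ 2 := by
    calc 1 / a / b * ‖x‖ ^ 2 ≤ 1 / a / b * (b * ‖A x‖ ^ 2) := by gcongr
      _ = 1 / a * ‖A x‖ ^ 2 := by field_simp
  have h3 : (1 - 1 / a / b) * ‖x‖ ^ 2 ≤ c * ‖x‖ ^ 2 := by gcongr; exact le_max_right _ _
  linarith

end Contraction

section Weights

theorem zr_add {d : ℕ} (x y : Fin d → ℤ) : zr (x + y) = zr x + zr y := by
  ext i; simp [zr]

theorem zr_neg {d : ℕ} (x : Fin d → ℤ) : zr (-x) = -zr x := by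
  ext i; simp [zr]

theorem zr_zero {d : ℕ} : zr (0 : Fin d → ℤ) = 0 := by
  ext i; simp [zr]

theorem schur_lt_top_of_finite {ι : Type*} [Finite ι] {f : ι → ι → ℝ≥0∞}
    (hf : ∀ k l, f k l < ⊤) : schur f < ⊤ := by
  have := Fintype.ofFinite ι
  have h : ∀ k, ∑ l, f k l < ⊤ := fun k => ENNReal.sum_lt_top.2 fun l _ => hf k l
  have h' : ∀ l, ∑ k, f k l < ⊤ := fun l => ENNReal.sum_lt_top.2 fun k _ => hf k l
  refine (schur_le (c := ∑ k, ∑ l, f k l) (fun k => ?_) (fun l => ?_)).trans_lt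
    (ENNReal.sum_lt_top.2 fun k _ => h k)
  · rw [tsum_fintype]
    exact Finset.single_le_sum (f := fun k => ∑ l, f k l) (fun _ _ => zero_le) (Finset.mem_univ k)
  · rw [tsum_fintype]
    exact Finset.sum_le_sum fun k _ =>
      Finset.single_le_sum (f := fun l => f k l) (fun _ _ => zero_le) (Finset.mem_univ l)

theorem tsum_indicator_norm_le {d : ℕ} (n : ℕ) :
    ∑' x : Fin d → ℤ, (if ‖zr x‖ ≤ n then 1 else 0 : ℝ≥0∞) ≤ (2 * n + 1) ^ d := by
  classical
  rw [tsum_eq_sum (s := Finset.Icc (fun _ => -(n : ℤ)) (fun _ => (n : ℤ)))]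
  · refine (Finset.sum_le_sum (g := fun _ => 1) fun x _ => by split_ifs <;> simp).trans ?_
    have h : ((n : ℤ) + 1 + n).toNat = 2 * n + 1 := by omega
    simp [Pi.card_Icc, h]
  · intro x hx
    rw [if_neg]
    contrapose! hx
    have h := (pi_norm_le_iff_of_nonneg (Nat.cast_nonneg n)).1 hx
    rw [Finset.mem_Icc]
    constructor <;> intro i <;> have h1 := h i <;> rw [zr, Real.norm_eq_abs, abs_le] at h1
    · exact_mod_cast h1.1
    · exact_mod_cast h1.2

/-- The polynomial weight `(1 + |x|)^ε` on `ℤ^d`. -/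
noncomputable def polyWeight (d : ℕ) (ε : ℝ) (x : Fin d → ℤ) : ℝ≥0∞ :=
  ENNReal.ofReal ((1 + ‖zr x‖) ^ ε)

theorem polyWeight_add_le {d : ℕ} {ε : ℝ} (h0 : 0 ≤ ε) (h1 : ε ≤ 1) (x y : Fin d → ℤ) :
    polyWeight d ε (x + y) ≤ polyWeight d ε x + polyWeight d ε y := by
  unfold polyWeight
  rw [← ENNReal.ofReal_add (by positivity) (by positivity), zr_add]
  refine ENNReal.ofReal_le_ofReal (le_trans ?_
    (Real.rpow_add_le_add_rpow (by positivity) (by positivity) h0 h1))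
  refine Real.rpow_le_rpow (by positivity) ?_ h0
  linarith [norm_add_le (zr x) (zr y)]

theorem one_le_polyWeight {d : ℕ} {ε : ℝ} (h0 : 0 ≤ ε) (x : Fin d → ℤ) :
    1 ≤ polyWeight d ε x := by
  rw [polyWeight, ENNReal.one_le_ofReal]
  exact Real.one_le_rpow (by linarith [norm_nonneg (zr x)]) h0

theorem opSchur_one_weight_le {d : ℕ} {p ε : ℝ} (hp0 : 0 < p) (hε : 0 < ε)
    (T : lp (fun _ : Fin d → ℤ => ℂ) 2 →L[ℂ] lp (fun _ : Fin d → ℤ => ℂ) 2) {n : ℕ} (hn : n ≠ 0) :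
    opSchur p 1 T ≤ (2 * n + 1) ^ d * ‖T‖ₑ ^ p
      + ENNReal.ofReal ((n : ℝ) ^ (-ε)) * opSchur p (polyWeight d ε) T := by
  have hn' : (0 : ℝ) < n := by positivity
  have hnear : schur (fun k l : Fin d → ℤ => (if ‖zr (k - l)‖ ≤ n then 1 else 0 : ℝ≥0∞))
      ≤ (2 * n + 1) ^ d := by
    refine schur_le (fun k => ?_) (fun l => ?_)
    · exact ((Equiv.subLeft k).tsum_eq
        (fun x => (if ‖zr x‖ ≤ n then 1 else 0 : ℝ≥0∞))).trans_le (tsum_indicator_norm_le n)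
    · exact ((Equiv.subRight l).tsum_eq
        (fun x => (if ‖zr x‖ ≤ n then 1 else 0 : ℝ≥0∞))).trans_le (tsum_indicator_norm_le n)
  calc opSchur p 1 T
      ≤ schur (fun k l : Fin d → ℤ => ‖T‖ₑ ^ p * (if ‖zr (k - l)‖ ≤ n then 1 else 0 : ℝ≥0∞)
        + ENNReal.ofReal ((n : ℝ) ^ (-ε)) *
          (‖T (lp.single 2 l 1) k‖ₑ ^ p * polyWeight d ε (k - l))) := by
        refine schur_mono fun k l => ?_
        rw [Pi.one_apply, mul_one]
        split_ifs with h
        · refine le_add_right ?_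
          rw [mul_one]
          refine ENNReal.rpow_le_rpow ?_ hp0.le
          exact enorm_le_iff_norm_le.2 (norm_entry_le T k l)
        · refine le_add_left ?_
          rw [mul_left_comm]
          refine le_mul_of_one_le_right' ?_
          rw [polyWeight, ← ENNReal.ofReal_mul (by positivity), ENNReal.one_le_ofReal,
            Real.rpow_neg hn'.le, ← div_eq_inv_mul, one_le_div (by positivity)]
          exact Real.rpow_le_rpow hn'.le (by linarith [not_le.1 h]) hε.le
    _ ≤ ‖T‖ₑ ^ p * (2 * n + 1) ^ d
      + ENNReal.ofReal ((n : ℝ) ^ (-ε)) * opSchur p (polyWeight d ε) T :=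
        (schur_add_le _ _).trans (add_le_add
          ((schur_const_mul_le _ _).trans (mul_le_mul_right hnear _)) (schur_const_mul_le _ _))
    _ = _ := by rw [mul_comm (‖T‖ₑ ^ p)]

/-- For a strict contraction `R` with polynomially decaying matrix, some power of `R` has
unweighted Schur `p`-norm below one. -/
theorem exists_opSchur_one_pow_lt_one {d : ℕ} {p ε : ℝ} (hp0 : 0 < p) (hp1 : p ≤ 1)
    (hε : 0 < ε) (hε1 : ε ≤ 1)
    {R : lp (fun _ : Fin d → ℤ => ℂ) 2 →L[ℂ] lp (fun _ : Fin d → ℤ => ℂ) 2} (hR : ‖R‖ < 1)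
    (hRw : opSchur p (polyWeight d ε) R < ⊤) : ∃ k ≠ 0, opSchur p 1 (R ^ k) < 1 := by
  have hle : ∀ T : lp (fun _ : Fin d → ℤ => ℂ) 2 →L[ℂ] lp (fun _ : Fin d → ℤ => ℂ) 2,
      opSchur p 1 T ≤ opSchur p (polyWeight d ε) T := fun T =>
    schur_mono fun k l => mul_le_mul_right (one_le_polyWeight hε.le (k - l)) _
  have hdouble : ∀ j : ℕ, opSchur p (polyWeight d ε) (R ^ 2 ^ (j + 1))
      ≤ 2 * opSchur p (polyWeight d ε) (R ^ 2 ^ j) * opSchur p 1 (R ^ 2 ^ j) := by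
    intro j
    rw [pow_succ 2 j, mul_two, pow_add]
    refine (opSchur_mul_le_of_subadditive hp0 hp1 (polyWeight_add_le hε.le hε1) _ _).trans_eq ?_
    ring
  have hfin : ∀ j : ℕ, opSchur p (polyWeight d ε) (R ^ 2 ^ j) < ⊤ := by
    intro j
    induction j with
    | zero => simpa using hRw
    | succ j ih =>
      exact (hdouble j).trans_lt (ENNReal.mul_lt_top (ENNReal.mul_lt_top (by simp) ih)
        ((hle _).trans_lt ih))
  have hfin1 : ∀ j : ℕ, opSchur p 1 (R ^ 2 ^ j) < ⊤ := fun j => (hle _).trans_lt (hfin j)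
  set r := max ‖R‖ (1 / 2) with hr
  have hr0 : 0 < r := lt_max_of_lt_right (by norm_num)
  have hr1 : r < 1 := max_lt hR (by norm_num)
  set β := -Real.log r * p with hβ
  have hβ0 : 0 < β := mul_pos (neg_pos.2 (Real.log_neg hr0 hr1)) hp0
  have hrβ : ∀ m : ℕ, (r ^ m) ^ p = Real.exp (-(β * m)) := by
    intro m
    rw [Real.rpow_def_of_pos (by positivity), Real.log_pow, hβ]
    congr 1; ring
  set α := β / (d + ε) with hα
  have hα0 : 0 < α := by positivity
  have hαβ : α * d + α * ε = β := by rw [hα]; field_simp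
  obtain ⟨j, hj⟩ := exists_lt_one_of_bootstrap
    (X := fun j => (opSchur p (polyWeight d ε) (R ^ 2 ^ j)).toReal)
    (Y := fun j => (opSchur p 1 (R ^ 2 ^ j)).toReal) (C := 5 ^ d) (γ := α * ε)
    (by positivity) (by positivity)
    (fun j => by
      have := ENNReal.toReal_mono (ENNReal.mul_ne_top
        (ENNReal.mul_ne_top (by simp) (hfin j).ne) (hfin1 j).ne) (hdouble j)
      simpa using this)
    (fun j => by
      set N : ℕ := 2 ^ j with hN
      set n : ℕ := ⌈Real.exp (α * N)⌉₊ with hn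
      have hn1 : Real.exp (α * N) ≤ n := Nat.le_ceil _
      have hn0 : n ≠ 0 := (Nat.ceil_pos.2 (Real.exp_pos _)).ne'
      have hn2 : (2 * n + 1 : ℝ) ≤ 5 * Real.exp (α * N) := by
        have h1 := (Nat.ceil_lt_add_one (Real.exp_pos (α * N)).le).le
        have h2 : 1 ≤ Real.exp (α * N) := Real.one_le_exp (by positivity)
        linarith
      have hnorm : ‖R ^ N‖ₑ ≤ ENNReal.ofReal (r ^ N) := by
        rw [← ofReal_norm]
        refine ENNReal.ofReal_le_ofReal ((norm_pow_le' R (by positivity)).trans ?_)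
        gcongr
        exact le_max_left _ _
      have hN' : (N : ℝ) = 2 ^ j := by rw [hN]; push_cast; rfl
      have h := opSchur_one_weight_le hp0 hε (R ^ N) hn0
      have h' : opSchur p 1 (R ^ N) ≤ ENNReal.ofReal ((2 * n + 1) ^ d * (r ^ N) ^ p
          + (n : ℝ) ^ (-ε) * (opSchur p (polyWeight d ε) (R ^ N)).toReal) := by
        refine h.trans ?_
        rw [ENNReal.ofReal_add (by positivity) (by positivity),
          ENNReal.ofReal_mul (by positivity), ENNReal.ofReal_mul (by positivity),
          ENNReal.ofReal_toReal (hfin j).ne, ENNReal.ofReal_pow (by positivity),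
          ← ENNReal.ofReal_rpow_of_nonneg (by positivity) hp0.le,
          ENNReal.ofReal_add (by positivity) (by positivity), ENNReal.ofReal_mul (by positivity)]
        simp only [ENNReal.ofReal_natCast, ENNReal.ofReal_one, ENNReal.ofReal_ofNat]
        gcongr
      have h2 := ENNReal.toReal_le_of_le_ofReal (by positivity) h'
      have hpow : (2 * n + 1 : ℝ) ^ d * (r ^ N) ^ p ≤ 5 ^ d * Real.exp (-(α * ε * 2 ^ j)) := by
        calc (2 * n + 1 : ℝ) ^ d * (r ^ N) ^ p
            ≤ (5 * Real.exp (α * N)) ^ d * Real.exp (-(β * N)) := by rw [hrβ]; gcongr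
          _ = 5 ^ d * Real.exp (-(α * ε * 2 ^ j)) := by
            rw [mul_pow, mul_assoc, ← Real.exp_nat_mul, ← Real.exp_add, ← hN']
            congr 2
            rw [← hαβ]; ring
      have hneg : (n : ℝ) ^ (-ε) ≤ 5 ^ d * Real.exp (-(α * ε * 2 ^ j)) := by
        calc (n : ℝ) ^ (-ε) ≤ Real.exp (α * N) ^ (-ε) :=
              Real.rpow_le_rpow_of_nonpos (Real.exp_pos _) hn1 (by linarith)
          _ = Real.exp (-(α * ε * 2 ^ j)) := by
            rw [← Real.exp_mul, ← hN']; congr 1; ring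
          _ ≤ _ := le_mul_of_one_le_left (Real.exp_pos _).le (one_le_pow₀ (by norm_num))
      calc _ ≤ _ := h2
        _ ≤ 5 ^ d * Real.exp (-(α * ε * 2 ^ j)) + 5 ^ d * Real.exp (-(α * ε * 2 ^ j)) *
            (opSchur p (polyWeight d ε) (R ^ N)).toReal := by gcongr
        _ = _ := by ring)
  refine ⟨2 ^ j, by positivity, ?_⟩
  rw [← ENNReal.toReal_lt_toReal (hfin1 j).ne (by simp)]
  simpa using hj

/-- An unbounded admissible weight can be replaced by an equivalent one whose Schur `p`-norm of a
given matrix is below one, provided the unweighted Schur `p`-norm is. -/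
theorem exists_equiv_weight_opSchur_lt_one {d : ℕ} [Nonempty (Fin d)] {p : ℝ} (hp0 : 0 < p)
    {ω : (Fin d → ℝ) → ℝ} (hadm : IsAdmissibleWeight ω) (hwg : WeakGrowth ω)
    {T : lp (fun _ : Fin d → ℤ => ℂ) 2 →L[ℂ] lp (fun _ : Fin d → ℤ => ℂ) 2}
    (hTw : opSchur p (fun k => ENNReal.ofReal (ω (zr k)) ^ p) T < ⊤)
    (hT1 : opSchur p 1 T < 1) :
    ∃ w' : (Fin d → ℤ) → ℝ≥0∞, (∀ x y, w' (x + y) ≤ w' x * w' y) ∧ w' 0 ≤ 1 ∧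
      (∃ c : ℝ≥0∞, c ≠ ⊤ ∧ ∀ x, ENNReal.ofReal (ω (zr x)) ^ p ≤ c * w' x) ∧
      (∀ x, w' x ≤ ENNReal.ofReal (ω (zr x)) ^ p) ∧ opSchur p w' T < 1 := by
  obtain ⟨⟨N, ρ, hN0, hNz, hNadd, hNsmul, -, hconc, hρ0, hρn, hω⟩, hgrs⟩ := hadm
  have hmono := concaveOn_monotoneOn_of_nonneg hconc hρn
  have hwexp : ∀ x : Fin d → ℤ,
      ENNReal.ofReal (ω (zr x)) ^ p = ENNReal.ofReal (Real.exp (p * ρ (N (zr x)))) := by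
    intro x
    rw [hω, ENNReal.ofReal_rpow_of_pos (Real.exp_pos _), ← Real.exp_mul, mul_comm]
  have hunb : ∀ K : ℝ, ∃ M, 0 ≤ M ∧ K ≤ ρ M := by
    intro K
    obtain ⟨C, hC, δ, hδ, -, hg⟩ := hwg
    have ht : Tendsto (fun s : ℝ => C * s ^ δ) atTop atTop :=
      (tendsto_rpow_atTop hδ).const_mul_atTop hC
    obtain ⟨s, hs, hs1⟩ := ((ht.eventually (eventually_ge_atTop (Real.exp K))).and
      (eventually_ge_atTop (1 : ℝ))).exists
    refine ⟨N (fun _ => s), hN0 _, ?_⟩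
    have h1 := hg (fun _ => s)
    rw [hω, pi_norm_const, Real.norm_of_nonneg (by linarith)] at h1
    refine Real.exp_le_exp.1 (hs.trans (le_trans ?_ h1))
    gcongr
    linarith
  have hslope : ∀ κ : ℝ, 0 < κ → ∃ u, 0 < u ∧ ρ u ≤ κ * u := by
    intro κ hκ
    set m := N (fun _ => 1) with hm
    have hm0 : 0 < m := (hN0 _).lt_of_ne' fun h => by
      have := congrFun ((hNz _).1 h) (Classical.arbitrary (Fin d))
      simp at this
    have h1 := (Real.continuousAt_log one_ne_zero).tendsto.comp (hgrs (fun _ => 1))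
    rw [Real.log_one] at h1
    obtain ⟨n, hn, hn1⟩ := ((h1.eventually (gt_mem_nhds (mul_pos hκ hm0))).and
      (eventually_ge_atTop 1)).exists
    have hn0 : (0 : ℝ) < n := by exact_mod_cast hn1
    refine ⟨n * m, by positivity, ?_⟩
    simp only [Function.comp_apply] at hn
    rw [hω, hNsmul, Real.log_rpow (Real.exp_pos _), Real.log_exp, abs_of_pos hn0, ← hm,
      inv_mul_lt_iff₀ hn0] at hn
    linarith
  have hT1' := ne_top_of_lt hT1
  have hlim : Tendsto (fun L : ℝ => Real.exp (p * L⁻¹) * (opSchur p 1 T).toReal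
      + Real.exp (-(p * L)) *
        (opSchur p (fun k => ENNReal.ofReal (ω (zr k)) ^ p) T).toReal) atTop
      (nhds (Real.exp (p * 0) * (opSchur p 1 T).toReal + 0 *
        (opSchur p (fun k => ENNReal.ofReal (ω (zr k)) ^ p) T).toReal)) := by
    refine Tendsto.add (Tendsto.mul_const _ ?_) (Tendsto.mul_const _ ?_)
    · exact (Real.continuous_exp.tendsto _).comp (tendsto_inv_atTop_zero.const_mul p)
    · exact Real.tendsto_exp_neg_atTop_nhds_zero.comp (tendsto_id.const_mul_atTop hp0)
  have hlt : (opSchur p 1 T).toReal < 1 := by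
    simpa using (ENNReal.toReal_lt_toReal hT1' (by simp)).2 hT1
  rw [mul_zero, Real.exp_zero, one_mul, zero_mul, add_zero] at hlim
  obtain ⟨L, hL, hL0⟩ :=
    ((hlim.eventually (gt_mem_nhds hlt)).and (eventually_gt_atTop (0 : ℝ))).exists
  obtain ⟨M, hM0, hM⟩ := hunb (L + L⁻¹)
  obtain ⟨u, hu0, hu⟩ := hslope (L⁻¹ / (M + 1)) (by positivity)
  have hsub : ∀ s t, 0 ≤ s → 0 ≤ t → ρ (s + t + u) + ρ u ≤ ρ (s + u) + ρ (t + u) := by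
    intro s t hs ht
    have := concaveOn_add_le hconc hu0.le (show u ≤ t + u by linarith) hs
    rw [show t + u + s = s + t + u by ring, add_comm u s] at this
    linarith
  have hle : ∀ t, 0 ≤ t → ρ (t + u) - ρ u ≤ ρ t := by
    intro t ht
    have := concaveOn_add_le hconc le_rfl ht hu0.le
    rw [hρ0, zero_add, zero_add] at this
    linarith
  have hMu : ρ (M + u) - ρ u ≤ L⁻¹ := by
    have h1 := hconc.2 (show (0 : ℝ) ∈ Set.Ici 0 by simp)
      (show M + u ∈ Set.Ici (0 : ℝ) by simp; linarith)
      (show 0 ≤ M / (M + u) by positivity) (show 0 ≤ u / (M + u) by positivity)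
      (by field_simp)
    simp only [smul_eq_mul, hρ0, mul_zero, zero_add] at h1
    rw [div_mul_cancel₀ u (by positivity), div_mul_eq_mul_div, div_le_iff₀ (by positivity)] at h1
    have h2 : ρ u * M ≤ L⁻¹ * u := by
      calc ρ u * M ≤ L⁻¹ / (M + 1) * u * (M + 1) := by gcongr; linarith
        _ = L⁻¹ * u := by field_simp
    have h3 : (ρ (M + u) - ρ u) * u ≤ L⁻¹ * u := by linarith
    exact le_of_mul_le_mul_right h3 hu0
  have hnear : ∀ t, 0 ≤ t → t ≤ M → ρ (t + u) - ρ u ≤ L⁻¹ := by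
    intro t ht htM
    have := hmono (show t + u ∈ Set.Ici (0 : ℝ) by simp; linarith)
      (show M + u ∈ Set.Ici (0 : ℝ) by simp; linarith) (by linarith)
    linarith
  have hfar : ∀ t, M ≤ t → ρ (t + u) - ρ u ≤ ρ t - L := by
    intro t htM
    have := concaveOn_add_le hconc hM0 htM hu0.le
    linarith
  refine ⟨fun x => ENNReal.ofReal (Real.exp (p * (ρ (N (zr x) + u) - ρ u))), ?_, ?_,
    ⟨ENNReal.ofReal (Real.exp (p * ρ u)), ENNReal.ofReal_ne_top, ?_⟩, ?_, ?_⟩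
  · intro x y
    rw [← ENNReal.ofReal_mul (Real.exp_pos _).le, ← Real.exp_add, ← mul_add]
    refine ENNReal.ofReal_le_ofReal (Real.exp_le_exp.2 (mul_le_mul_of_nonneg_left ?_ hp0.le))
    have h1 := hsub _ _ (hN0 (zr x)) (hN0 (zr y))
    have h2 := hmono (show N (zr (x + y)) + u ∈ Set.Ici (0 : ℝ) from
        add_nonneg (hN0 _) hu0.le)
      (show N (zr x) + N (zr y) + u ∈ Set.Ici (0 : ℝ) from
        add_nonneg (add_nonneg (hN0 _) (hN0 _)) hu0.le)
      (by rw [zr_add]; linarith [hNadd (zr x) (zr y)])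
    linarith
  · simp [zr_zero, (hNz 0).2 rfl]
  · intro x
    rw [hwexp, ← ENNReal.ofReal_mul (Real.exp_pos _).le, ← Real.exp_add, ← mul_add]
    refine ENNReal.ofReal_le_ofReal (Real.exp_le_exp.2 (mul_le_mul_of_nonneg_left ?_ hp0.le))
    have := hmono (show N (zr x) ∈ Set.Ici (0 : ℝ) from hN0 _)
      (show N (zr x) + u ∈ Set.Ici (0 : ℝ) from add_nonneg (hN0 _) hu0.le) (by linarith)
    linarith
  · intro x
    rw [hwexp]
    exact ENNReal.ofReal_le_ofReal
      (Real.exp_le_exp.2 (mul_le_mul_of_nonneg_left (hle _ (hN0 _)) hp0.le))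
  · set Q := opSchur p (fun k => ENNReal.ofReal (ω (zr k)) ^ p) T with hQ
    have hbound : opSchur p
        (fun x => ENNReal.ofReal (Real.exp (p * (ρ (N (zr x) + u) - ρ u)))) T
        ≤ ENNReal.ofReal (Real.exp (p * L⁻¹)) * opSchur p 1 T
          + ENNReal.ofReal (Real.exp (-(p * L))) * Q := by
      refine (schur_mono fun k l => ?_).trans ((schur_add_le _ _).trans
        (add_le_add (schur_const_mul_le _ _) (schur_const_mul_le _ _)))
      rw [mul_left_comm, mul_left_comm (ENNReal.ofReal (Real.exp (-(p * L)))), ← mul_add]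
      refine mul_le_mul_right ?_ _
      rcases le_total (N (zr (k - l))) M with h | h
      · refine le_add_right ?_
        rw [Pi.one_apply, mul_one]
        exact ENNReal.ofReal_le_ofReal
          (Real.exp_le_exp.2 (mul_le_mul_of_nonneg_left (hnear _ (hN0 _) h) hp0.le))
      · refine le_add_left ?_
        beta_reduce
        rw [hwexp, ← ENNReal.ofReal_mul (Real.exp_pos _).le, ← Real.exp_add]
        refine ENNReal.ofReal_le_ofReal (Real.exp_le_exp.2 ?_)
        nlinarith [hfar _ h]
    refine hbound.trans_lt ?_
    rw [← ENNReal.ofReal_toReal hT1', ← ENNReal.ofReal_toReal hTw.ne,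
      ← ENNReal.ofReal_mul (Real.exp_pos _).le, ← ENNReal.ofReal_mul (Real.exp_pos _).le,
      ← ENNReal.ofReal_add (by positivity) (by positivity), ENNReal.ofReal_lt_one]
    exact hL

theorem IsAdmissibleWeight.submultiplicative {d : ℕ} {ω : (Fin d → ℝ) → ℝ}
    (hadm : IsAdmissibleWeight ω) (x y : Fin d → ℝ) : ω (x + y) ≤ ω x * ω y := by
  obtain ⟨⟨N, ρ, hN0, -, hNadd, -, -, hconc, hρ0, hρn, hω⟩, -⟩ := hadm
  rw [hω, hω, hω, ← Real.exp_add, Real.exp_le_exp]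
  have h1 := concaveOn_monotoneOn_of_nonneg hconc hρn (hN0 (x + y))
    (show N x + N y ∈ Set.Ici (0 : ℝ) from add_nonneg (hN0 _) (hN0 _)) (hNadd x y)
  have h2 := concaveOn_add_le hconc le_rfl (hN0 x) (hN0 y)
  rw [hρ0, zero_add, zero_add] at h2
  linarith

theorem IsAdmissibleWeight.even {d : ℕ} {ω : (Fin d → ℝ) → ℝ}
    (hadm : IsAdmissibleWeight ω) (x : Fin d → ℝ) : ω (-x) = ω x := by
  obtain ⟨⟨N, ρ, -, -, -, hNsmul, -, -, -, -, hω⟩, -⟩ := hadm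
  have h := hNsmul (-1) x
  rw [neg_one_smul, abs_neg, abs_one, one_mul] at h
  rw [hω, hω, h]

theorem IsAdmissibleWeight.apply_zero {d : ℕ} {ω : (Fin d → ℝ) → ℝ}
    (hadm : IsAdmissibleWeight ω) : ω 0 = 1 := by
  obtain ⟨⟨N, ρ, -, hNz, -, -, -, -, hρ0, -, hω⟩, -⟩ := hadm
  rw [hω, (hNz 0).2 rfl, hρ0, Real.exp_zero]

theorem IsAdmissibleWeight.pos {d : ℕ} {ω : (Fin d → ℝ) → ℝ}
    (hadm : IsAdmissibleWeight ω) (x : Fin d → ℝ) : 0 < ω x := by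
  obtain ⟨⟨N, ρ, -, -, -, -, -, -, -, -, hω⟩, -⟩ := hadm
  rw [hω]
  exact Real.exp_pos _

theorem exists_polyWeight_le {d : ℕ} {p : ℝ} (hp0 : 0 < p) (hp1 : p ≤ 1)
    {ω : (Fin d → ℝ) → ℝ} (hwg : WeakGrowth ω) :
    ∃ ε, 0 < ε ∧ ε ≤ 1 ∧ ∃ c : ℝ≥0∞, c ≠ ⊤ ∧
      ∀ x : Fin d → ℤ, polyWeight d ε x ≤ c * ENNReal.ofReal (ω (zr x)) ^ p := by
  obtain ⟨C, hC, δ, hδ, hδ1, hg⟩ := hwg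
  refine ⟨δ * p, by positivity, mul_le_one₀ hδ1 hp0.le hp1, ENNReal.ofReal (C⁻¹ ^ p),
    ENNReal.ofReal_ne_top, fun x => ?_⟩
  have hx : 0 < C * (1 + ‖zr x‖) ^ δ := by positivity
  rw [polyWeight, ENNReal.ofReal_rpow_of_pos (hx.trans_le (hg _)),
    ← ENNReal.ofReal_mul (by positivity), Real.rpow_mul (by positivity)]
  refine ENNReal.ofReal_le_ofReal ?_
  rw [← Real.mul_rpow (by positivity) (hx.trans_le (hg _)).le]
  refine Real.rpow_le_rpow (by positivity) ?_ hp0.le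
  rw [← div_eq_inv_mul, le_div_iff₀ hC, mul_comm]
  exact hg _

end Weights

/-- **Inverse-closedness of `p`-Beurling algebras of infinite matrices.**
Let `ω` be an admissible weight on `ℤ^d` satisfying the weak growth condition and
`0 < p ≤ 1`.  If `A` is an invertible bounded operator on `ℓ²(ℤ^d)` whose matrix
`a_{kl} = (A δ_l)(k)` satisfies the weighted Schur-type condition, then the matrix of the
inverse operator satisfies the same condition. -/
theorem inverse_closedness_of_matrix_algebra
    {d : ℕ} (p : ℝ) (hp0 : 0 < p) (hp1 : p ≤ 1)
    (ω : (Fin d → ℝ) → ℝ) (hadm : IsAdmissibleWeight ω) (hwg : WeakGrowth ω)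
    (A B : lp (fun _ : Fin d → ℤ => ℂ) 2 →L[ℂ] lp (fun _ : Fin d → ℤ => ℂ) 2)
    (hAB : A.comp B = ContinuousLinearMap.id ℂ (lp (fun _ : Fin d → ℤ => ℂ) 2))
    (hBA : B.comp A = ContinuousLinearMap.id ℂ (lp (fun _ : Fin d → ℤ => ℂ) 2))
    (hA : mnorm p (fun k => ω (zr k)) (fun k l => A (lp.single 2 l 1) k) < ⊤) :
    mnorm p (fun k => ω (zr k)) (fun k l => B (lp.single 2 l 1) k) < ⊤ := by
  set w : (Fin d → ℤ) → ℝ≥0∞ := fun k => ENNReal.ofReal (ω (zr k)) ^ p with hw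
  change opSchur p w A < ⊤ at hA
  change opSchur p w B < ⊤
  have hw0 : w 0 ≤ 1 := by simp [hw, zr_zero, hadm.apply_zero]
  have hwmul : ∀ x y, w (x + y) ≤ w x * w y := by
    intro x y
    simp only [hw]
    rw [← ENNReal.mul_rpow_of_nonneg _ _ hp0.le, ← ENNReal.ofReal_mul (hadm.pos _).le, zr_add]
    exact ENNReal.rpow_le_rpow (ENNReal.ofReal_le_ofReal (hadm.submultiplicative _ _)) hp0.le
  have hweven : ∀ x, w (-x) = w x := fun x => by simp only [hw, zr_neg, hadm.even]
  rcases isEmpty_or_nonempty (Fin d) with hd | hd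
  · exact schur_lt_top_of_finite fun k l => ENNReal.mul_lt_top
      (ENNReal.rpow_lt_top_of_nonneg hp0.le (by simp))
      (ENNReal.rpow_lt_top_of_nonneg hp0.le (by simp))
  have hBA' : B * A = 1 := hBA
  have hAB' : A * B = 1 := hAB
  have hAdj : opSchur p w (ContinuousLinearMap.adjoint A) < ⊤ := by
    rwa [opSchur_adjoint hweven]
  obtain ⟨t, ht, hR⟩ := exists_norm_one_sub_smul_adjoint_mul_lt_one hBA'
  set R := 1 - (t : ℂ) • (ContinuousLinearMap.adjoint A * A) with hRdef
  have ht' : (t : ℂ) ≠ 0 := by exact_mod_cast ht.ne'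
  have hRw : opSchur p w R < ⊤ := by
    rw [hRdef, sub_eq_add_neg, ← neg_smul]
    refine (opSchur_add_le hp0 hp1 _ _).trans_lt (ENNReal.add_lt_top.2 ⟨?_, ?_⟩)
    · exact (opSchur_one_le hp0).trans_lt (hw0.trans_lt ENNReal.one_lt_top)
    · exact (opSchur_smul_le hp0 _ _).trans_lt (ENNReal.mul_lt_top
        (ENNReal.rpow_lt_top_of_nonneg hp0.le (by simp))
        ((opSchur_mul_le hp0 hp1 hwmul _ _).trans_lt (ENNReal.mul_lt_top hAdj hA)))
  obtain ⟨ε, hε, hε1, c, hc, hpoly⟩ := exists_polyWeight_le hp0 hp1 hwg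
  obtain ⟨k, hk, hRk⟩ := exists_opSchur_one_pow_lt_one hp0 hp1 hε hε1 hR
    ((opSchur_le_const_mul hpoly R).trans_lt (ENNReal.mul_lt_top hc.lt_top hRw))
  obtain ⟨w', hw'mul, hw'0, ⟨c', hc', hww'⟩, hw'w, hw'1⟩ :=
    exists_equiv_weight_opSchur_lt_one hp0 hadm hwg
      ((opSchur_pow_le hp0 hp1 hwmul hw0 R k).trans_lt (ENNReal.pow_lt_top hRw)) hRk
  have hRw' : opSchur p w' R < ⊤ :=
    (schur_mono fun k l => mul_le_mul_right (hw'w (k - l)) _).trans_lt hRw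
  have hadj1 : ContinuousLinearMap.adjoint A * ContinuousLinearMap.adjoint B = 1 := by
    simp only [← ContinuousLinearMap.star_eq_adjoint]
    rw [← star_mul, hBA', star_one]
  have hadj2 : ContinuousLinearMap.adjoint B * ContinuousLinearMap.adjoint A = 1 := by
    simp only [← ContinuousLinearMap.star_eq_adjoint]
    rw [← star_mul, hAB', star_one]
  have hS : (1 - R) * ((t : ℂ)⁻¹ • (B * ContinuousLinearMap.adjoint B)) = 1 := by
    rw [hRdef, sub_sub_cancel, smul_mul_smul_comm, mul_inv_cancel₀ ht', one_smul, mul_assoc,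
      ← mul_assoc A, hAB', one_mul, hadj1]
  have hSw := opSchur_leftInverse_lt_top hp0 hp1 hw'mul hw'0 hR hRw' hk hw'1 hS
  have hB : B = (t : ℂ) • (((t : ℂ)⁻¹ • (B * ContinuousLinearMap.adjoint B))
      * ContinuousLinearMap.adjoint A) := by
    rw [smul_mul_assoc, smul_smul, mul_inv_cancel₀ ht', one_smul, mul_assoc, hadj2, mul_one]
  rw [hB]
  exact (opSchur_smul_le hp0 _ _).trans_lt (ENNReal.mul_lt_top
    (ENNReal.rpow_lt_top_of_nonneg hp0.le (by simp))
    ((opSchur_mul_le hp0 hp1 hwmul _ _).trans_lt (ENNReal.mul_lt_top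
      ((opSchur_le_const_mul hww' _).trans_lt (ENNReal.mul_lt_top hc'.lt_top hSw)) hAdj)))
end
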